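/- Let p ∈ (1,∞), let Ω ⊆ ℝ^d be a domain, and let V₀, V₁ ∈ L^∞_loc(Ω) be real-valued. For s ∈ ℝ define Q_s(u) := s·Q_{V₁}(u) + (1−s)·Q_{V₀}(u) = Q_{sV₁+(1−s)V₀}(u) for u ∈ C_c^∞(Ω). If Q_{V₀} and Q_{V₁} are both nonnegative in Ω, then Q_s is nonnegative in Ω for every s ∈ [0,1]; moreover, if additionally V₀ ≠ V₁ on a set of positive Lebesgue measure, then Q_s is subcritical in Ω for every s ∈ (0,1). -/

import Mathlib

open MeasureTheory Filter
open scoped Topology RealInnerProductSpace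

noncomputable section

abbrev Ed (d : ℕ) := EuclideanSpace ℝ (Fin d)

/-- A smooth test function compactly supported inside Ω. -/
def IsTestOn {d : ℕ} (Ω : Set (Ed d)) (u : Ed d → ℝ) : Prop :=
  ContDiff ℝ (⊤ : ℕ∞) u ∧ HasCompactSupport u ∧ tsupport u ⊆ Ω

/-- `V ∈ L^∞_loc(Ω)`. -/
def LocBddOn {d : ℕ} (Ω : Set (Ed d)) (V : Ed d → ℝ) : Prop :=
  Measurable V ∧ ∀ K : Set (Ed d), IsCompact K → K ⊆ Ω →
    ∃ M : ℝ, ∀ᵐ x ∂(volume : Measure (Ed d)), x ∈ K → |V x| ≤ M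

/-- The functional `Q_V(u) = ∫_Ω (|∇u|^p + V|u|^p) dx`. -/
def Qp {d : ℕ} (p : ℝ) (Ω : Set (Ed d)) (V : Ed d → ℝ) (u : Ed d → ℝ) : ℝ :=
  ∫ x in Ω, (‖gradient u x‖ ^ p + V x * |u x| ^ p)

/-- `Q_V` is nonnegative in Ω. -/
def NonnegOn {d : ℕ} (p : ℝ) (Ω : Set (Ed d)) (V : Ed d → ℝ) : Prop :=
  ∀ u, IsTestOn Ω u → 0 ≤ Qp p Ω V u

/-- `Q_V` is subcritical (strictly positive) in Ω: there is a continuous function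
`W > 0` on Ω with `Q_V(u) ≥ ∫_Ω W|u|^p` for all test functions `u`. -/
def SubcriticalOn {d : ℕ} (p : ℝ) (Ω : Set (Ed d)) (V : Ed d → ℝ) : Prop :=
  ∃ W : Ed d → ℝ, ContinuousOn W Ω ∧ (∀ x ∈ Ω, 0 < W x) ∧
    ∀ u, IsTestOn Ω u → (∫ x in Ω, W x * |u x| ^ p) ≤ Qp p Ω V u

/-- A null sequence for `Q_V` in Ω. -/
def NullSeqOn {d : ℕ} (p : ℝ) (Ω : Set (Ed d)) (V : Ed d → ℝ)
    (un : ℕ → Ed d → ℝ) : Prop :=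
  (∀ n, IsTestOn Ω (un n)) ∧ (∀ n x, 0 ≤ un n x) ∧
  (∃ B : Set (Ed d), IsOpen B ∧ IsCompact (closure B) ∧ closure B ⊆ Ω ∧
    ∀ n, (∫ x in B, |un n x| ^ p) = 1) ∧
  Tendsto (fun n => Qp p Ω V (un n)) atTop (𝓝 0)

/-- A ground state of `Q_V` in Ω: a positive C¹ function on Ω that is the limit of
a null sequence in `L^p(K)` for every compact `K ⊆ Ω`. -/
def IsGroundStateOn {d : ℕ} (p : ℝ) (Ω : Set (Ed d)) (V : Ed d → ℝ)
    (φ : Ed d → ℝ) : Prop :=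
  ContDiffOn ℝ 1 φ Ω ∧ (∀ x ∈ Ω, 0 < φ x) ∧
  ∃ un, NullSeqOn p Ω V un ∧ ∀ K : Set (Ed d), IsCompact K → K ⊆ Ω →
    Tendsto (fun n => ∫ x in K, |un n x - φ x| ^ p) atTop (𝓝 0)

/-- `Q_V` is critical in Ω. -/
def CriticalOn {d : ℕ} (p : ℝ) (Ω : Set (Ed d)) (V : Ed d → ℝ) : Prop :=
  NonnegOn p Ω V ∧ ∃ φ, IsGroundStateOn p Ω V φ

/-- A positive weak supersolution of `-Δ_p v + V|v|^{p-2}v = 0` in Ω. -/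
def IsSupersolOn {d : ℕ} (p : ℝ) (Ω : Set (Ed d)) (V : Ed d → ℝ)
    (v : Ed d → ℝ) : Prop :=
  ContDiffOn ℝ 1 v Ω ∧ (∀ x ∈ Ω, 0 < v x) ∧
  ∀ φ, IsTestOn Ω φ → (∀ x, 0 ≤ φ x) →
    0 ≤ ∫ x in Ω, (‖gradient v x‖ ^ (p - 2) * ⟪gradient v x, gradient φ x⟫ +
      V x * v x ^ (p - 1) * φ x)

/-- A positive weak solution of `-Δ_p v + V|v|^{p-2}v = 0` in Ω. -/
def IsSolOn {d : ℕ} (p : ℝ) (Ω : Set (Ed d)) (V : Ed d → ℝ)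
    (v : Ed d → ℝ) : Prop :=
  ContDiffOn ℝ 1 v Ω ∧ (∀ x ∈ Ω, 0 < v x) ∧
  ∀ φ, IsTestOn Ω φ →
    (∫ x in Ω, (‖gradient v x‖ ^ (p - 2) * ⟪gradient v x, gradient φ x⟫ +
      V x * v x ^ (p - 1) * φ x)) = 0

namespace S17


variable {d : ℕ} {p : ℝ} {Ω : Set (Ed d)} {V u : Ed d → ℝ}

lemma test_cont (hu : IsTestOn Ω u) : Continuous u := hu.1.continuous

lemma test_diff (hu : IsTestOn Ω u) : Differentiable ℝ u :=
  hu.1.differentiable (by simp)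

lemma test_fcont (hu : IsTestOn Ω u) : Continuous (fderiv ℝ u) :=
  hu.1.continuous_fderiv (by simp)

lemma int_grad (hp : 0 < p) (hu : IsTestOn Ω u) :
    Integrable (fun x => ‖fderiv ℝ u x‖ ^ p) := by
  apply Continuous.integrable_of_hasCompactSupport
  · exact (test_fcont hu).norm.rpow_const (fun x => Or.inr hp.le)
  · have h := hu.2.1.fderiv (𝕜 := ℝ)
    refine h.mono ?_
    intro x hx
    simp only [Function.mem_support] at hx ⊢
    intro h0
    exact hx (by simp [h0, Real.zero_rpow hp.ne'])

/-- products of locally bounded and compactly supported continuous functions -/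
lemma int_V (hV : LocBddOn Ω V) {g : Ed d → ℝ} (hg : Continuous g) (hc : HasCompactSupport g)
    (hs : tsupport g ⊆ Ω) : Integrable (fun x => V x * g x) := by
  obtain ⟨M, hM⟩ := hV.2 (tsupport g) hc hs
  have hi : Integrable g := hg.integrable_of_hasCompactSupport hc
  refine Integrable.mono' (hi.norm.const_mul M) (hV.1.aestronglyMeasurable.mul hg.aestronglyMeasurable) ?_
  filter_upwards [hM] with x hx
  by_cases hxs : x ∈ tsupport g
  · rw [norm_mul]
    exact mul_le_mul_of_nonneg_right (hx hxs) (norm_nonneg _)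
  · rw [image_eq_zero_of_notMem_tsupport hxs]; simp

lemma abs_rpow_supp (hp : 0 < p) (hu : IsTestOn Ω u) :
    Continuous (fun x => |u x| ^ p) ∧ HasCompactSupport (fun x => |u x| ^ p) ∧
      tsupport (fun x => |u x| ^ p) ⊆ Ω := by
  have hsub : Function.support (fun x => |u x| ^ p) ⊆ Function.support u := by
    intro x hx
    simp only [Function.mem_support] at hx ⊢
    intro h0
    exact hx (by simp [h0, Real.zero_rpow hp.ne'])
  refine ⟨(test_cont hu).abs.rpow_const (fun x => Or.inr hp.le), hu.2.1.mono hsub, ?_⟩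
  exact (closure_mono hsub).trans hu.2.2

lemma int_pow (hp : 0 < p) (hu : IsTestOn Ω u) : Integrable (fun x => |u x| ^ p) :=
  let h := abs_rpow_supp hp hu
  h.1.integrable_of_hasCompactSupport h.2.1

lemma int_Vpow (hp : 0 < p) (hV : LocBddOn Ω V) (hu : IsTestOn Ω u) :
    Integrable (fun x => V x * |u x| ^ p) :=
  let h := abs_rpow_supp hp hu
  int_V hV h.1 h.2.1 h.2.2

lemma Qp_eq (hp : 0 < p) (hu : IsTestOn Ω u) :
    Qp p Ω V u = ∫ x, (‖fderiv ℝ u x‖ ^ p + V x * |u x| ^ p) := by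
  unfold Qp
  have : ∀ x, ‖gradient u x‖ = ‖fderiv ℝ u x‖ := by intro x; simp [gradient]
  simp only [this]
  apply setIntegral_eq_integral_of_forall_compl_eq_zero
  intro x hx
  have hx' : x ∉ tsupport u := fun h => hx (hu.2.2 h)
  have h1 : u x = 0 := image_eq_zero_of_notMem_tsupport hx'
  have h2 : fderiv ℝ u x = 0 := by
    have := (tsupport_fderiv_subset ℝ (f := u))
    exact image_eq_zero_of_notMem_tsupport (fun h => hx' (this h))
  simp [h1, h2, Real.zero_rpow hp.ne']

lemma int_dens (hp : 0 < p) (hV : LocBddOn Ω V) (hu : IsTestOn Ω u) :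
    Integrable (fun x => ‖fderiv ℝ u x‖ ^ p + V x * |u x| ^ p) :=
  (int_grad hp hu).add (int_Vpow hp hV hu)

/-- comparison principle -/
lemma cmp (hp : 0 < p) (hV : LocBddOn Ω V) (hQ : NonnegOn p Ω V) {f : Ed d → ℝ}
    (hu : IsTestOn Ω u) (hf : IsTestOn Ω f) {F G : Ed d → ℝ} (hF : Integrable F) (hG : Integrable G)
    (h : ∀ᵐ x, F x + (‖fderiv ℝ f x‖ ^ p + V x * |f x| ^ p) ≤
      (‖fderiv ℝ u x‖ ^ p + V x * |u x| ^ p) + G x) :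
    ∫ x, F x ≤ Qp p Ω V u + ∫ x, G x := by
  have h0 := hQ f hf
  rw [Qp_eq hp hf] at h0
  rw [Qp_eq hp hu, ← integral_add (int_dens hp hV hu) hG]
  have := integral_mono_ae (hF.add (int_dens hp hV hf)) ((int_dens hp hV hu).add hG) h
  simp only [Pi.add_apply] at this
  rw [integral_add hF (int_dens hp hV hf)] at this
  linarith

lemma test_smul (c : ℝ) (hu : IsTestOn Ω u) : IsTestOn Ω (fun x => c * u x) := by
  refine ⟨contDiff_const.mul hu.1, ?_, ?_⟩
  · exact hu.2.1.mul_left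
  · exact (tsupport_mul_subset_right).trans hu.2.2

lemma Qp_smul (hp : 0 < p) {c : ℝ} (hc : 0 ≤ c) (hu : IsTestOn Ω u) :
    Qp p Ω V (fun x => c * u x) = c ^ p * Qp p Ω V u := by
  rw [Qp_eq hp hu, Qp_eq hp (test_smul c hu), ← integral_const_mul]
  congr 1
  ext x
  have : fderiv ℝ (fun x => c * u x) x = c • fderiv ℝ u x :=
    fderiv_const_mul (test_diff hu x) c
  rw [this, norm_smul, abs_mul, Real.mul_rpow (norm_nonneg _) (norm_nonneg _),
    Real.mul_rpow (abs_nonneg _) (abs_nonneg _), Real.norm_eq_abs, abs_of_nonneg hc]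
  ring

/-- convexity of powers -/
lemma conv_pow (hp : 1 ≤ p) {l A b : ℝ} (h0 : 0 ≤ l) (h1 : l ≤ 1) (hA : 0 ≤ A) (hb : 0 ≤ b) :
    ((1 - l) * A + l * b) ^ p ≤ (1 - l) * A ^ p + l * b ^ p := by
  have := (convexOn_rpow hp).2 (Set.mem_Ici.2 hA) (Set.mem_Ici.2 hb) (sub_nonneg.2 h1) h0 (by ring)
  simpa [smul_eq_mul] using this

/-- one-segment estimate -/
lemma seg (hp : 1 ≤ p) {h : Ed d → ℝ} (hh : ContDiff ℝ 1 h) (x z : Ed d) :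
    ENNReal.ofReal (|h (x + z) - h x| ^ p) ≤
      ENNReal.ofReal (‖z‖ ^ p) *
        ∫⁻ t in Set.Icc (0:ℝ) 1, ENNReal.ofReal (‖fderiv ℝ h (x + t • z)‖ ^ p) := by
  have hp0 : 0 < p := by linarith
  have hdc : Continuous (fderiv ℝ h) := hh.continuous_fderiv (by simp)
  set g : ℝ → ℝ := fun t => ‖fderiv ℝ h (x + t • z)‖ with hg
  have hgc : Continuous g := by
    exact (hdc.comp (by fun_prop)).norm
  have hgd : ∀ t : ℝ, HasDerivAt (fun t : ℝ => h (x + t • z)) (fderiv ℝ h (x + t • z) z) t := by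
    intro t
    have h1 : HasDerivAt (fun t : ℝ => x + t • z) z t := by
      simpa using ((hasDerivAt_id t).smul_const z).const_add x
    exact ((hh.differentiable (by simp) _).hasFDerivAt).comp_hasDerivAt t h1
  have hint : ∫ t in (0:ℝ)..1, fderiv ℝ h (x + t • z) z = h (x + z) - h x := by
    have := intervalIntegral.integral_eq_sub_of_hasDerivAt (a := 0) (b := 1)
      (f := fun t : ℝ => h (x + t • z)) (fun t _ => hgd t)
      (Continuous.intervalIntegrable (by
        exact (hdc.comp (by fun_prop : Continuous fun t : ℝ => x + t • z)).clm_apply continuous_const) _ _)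
    simpa using this
  have h1 : |h (x + z) - h x| ≤ ‖z‖ * ∫ t in Set.Icc (0:ℝ) 1, g t := by
    rw [← hint, ← Real.norm_eq_abs, integral_Icc_eq_integral_Ioc, ← intervalIntegral.integral_of_le zero_le_one, ← intervalIntegral.integral_const_mul]
    refine (intervalIntegral.norm_integral_le_of_norm_le zero_le_one (g := fun t => ‖z‖ * g t) ?_ ?_)
    · refine Eventually.of_forall fun t _ => ?_
      rw [mul_comm]; exact (fderiv ℝ h (x + t • z)).le_opNorm z
    · exact (continuous_const.mul hgc).intervalIntegrable _ _
  have hprob : IsProbabilityMeasure (volume.restrict (Set.Icc (0:ℝ) 1)) := ⟨by simp⟩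
  have hgi : Integrable g (volume.restrict (Set.Icc (0:ℝ) 1)) :=
    hgc.continuousOn.integrableOn_Icc
  have hgpc : Continuous (fun t => g t ^ p) := hgc.rpow_const (fun _ => Or.inr hp0.le)
  have hgpi : Integrable (fun t => g t ^ p) (volume.restrict (Set.Icc (0:ℝ) 1)) :=
    hgpc.continuousOn.integrableOn_Icc
  have h2 := (convexOn_rpow hp).map_integral_le (μ := volume.restrict (Set.Icc (0:ℝ) 1)) (f := g)
    (Real.continuous_rpow_const hp0.le).continuousOn isClosed_Ici
    (Eventually.of_forall fun t => norm_nonneg _) hgi hgpi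
  rw [← ofReal_integral_eq_lintegral_ofReal hgpi (Eventually.of_forall fun t => by positivity),
    ← ENNReal.ofReal_mul (by positivity)]
  apply ENNReal.ofReal_le_ofReal
  have h3 : 0 ≤ ∫ t in Set.Icc (0:ℝ) 1, g t := integral_nonneg fun t => norm_nonneg _
  calc |h (x + z) - h x| ^ p ≤ (‖z‖ * ∫ t in Set.Icc (0:ℝ) 1, g t) ^ p :=
        Real.rpow_le_rpow (abs_nonneg _) h1 hp0.le
    _ = ‖z‖ ^ p * (∫ t in Set.Icc (0:ℝ) 1, g t) ^ p := Real.mul_rpow (norm_nonneg _) h3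
    _ ≤ _ := mul_le_mul_of_nonneg_left h2 (by positivity)

lemma transl (hp : 1 ≤ p) {h : Ed d → ℝ} (hh : ContDiff ℝ 1 h) (x0 z : Ed d) {r l : ℝ} (hz : ‖z‖ ≤ l) :
    ∫⁻ x in Metric.closedBall x0 r, ENNReal.ofReal (|h (x + z) - h x| ^ p) ≤
      ENNReal.ofReal (l ^ p) *
        ∫⁻ x in Metric.closedBall x0 (r + l), ENNReal.ofReal (‖fderiv ℝ h x‖ ^ p) := by
  have hp0 : 0 < p := by linarith
  have hdc : Continuous (fderiv ℝ h) := hh.continuous_fderiv (by simp)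
  set G : Ed d → ENNReal := fun x => ENNReal.ofReal (‖fderiv ℝ h x‖ ^ p) with hG
  have hGc : Continuous G :=
    ENNReal.continuous_ofReal.comp (hdc.norm.rpow_const (fun _ => Or.inr hp0.le))
  calc _ ≤ ∫⁻ x in Metric.closedBall x0 r, ENNReal.ofReal (l ^ p) * ∫⁻ t in Set.Icc (0:ℝ) 1, G (x + t • z) := by
        apply lintegral_mono
        intro x
        refine (seg hp hh x z).trans ?_
        exact mul_le_mul' (ENNReal.ofReal_le_ofReal (Real.rpow_le_rpow (norm_nonneg _) hz hp0.le)) le_rfl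
    _ = ENNReal.ofReal (l ^ p) * ∫⁻ x in Metric.closedBall x0 r, ∫⁻ t in Set.Icc (0:ℝ) 1, G (x + t • z) := by
        rw [lintegral_const_mul' _ _ ENNReal.ofReal_ne_top]
    _ = ENNReal.ofReal (l ^ p) * ∫⁻ t in Set.Icc (0:ℝ) 1, ∫⁻ x in Metric.closedBall x0 r, G (x + t • z) := by
        rw [lintegral_lintegral_swap]
        have : Continuous (Function.uncurry fun (x : Ed d) (t : ℝ) => G (x + t • z)) := by
          exact hGc.comp (by fun_prop)
        exact this.measurable.aemeasurable
    _ ≤ ENNReal.ofReal (l ^ p) * ∫⁻ t in Set.Icc (0:ℝ) 1, ∫⁻ x in Metric.closedBall x0 (r + l), G x := by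
        gcongr 1
        apply setLIntegral_mono' measurableSet_Icc
        intro t ht
        rw [← lintegral_indicator measurableSet_closedBall, ← lintegral_indicator measurableSet_closedBall,
          ← lintegral_add_right_eq_self ((Metric.closedBall x0 (r + l)).indicator G) (t • z)]
        apply lintegral_mono
        intro x
        by_cases hx : x ∈ Metric.closedBall x0 r
        · have hx2 : x + t • z ∈ Metric.closedBall x0 (r + l) := by
            rw [Metric.mem_closedBall, dist_eq_norm] at hx ⊢
            calc ‖x + t • z - x0‖ = ‖(x - x0) + t • z‖ := by congr 1; abel
              _ ≤ ‖x - x0‖ + ‖t • z‖ := norm_add_le _ _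
              _ ≤ r + l := by
                rw [norm_smul, Real.norm_eq_abs, abs_of_nonneg ht.1]
                have : t * ‖z‖ ≤ 1 * ‖z‖ := mul_le_mul_of_nonneg_right ht.2 (norm_nonneg _)
                linarith
          simp only [Set.indicator_of_mem hx, Set.indicator_of_mem hx2, le_refl]
        · simp only [Set.indicator_of_notMem hx]; exact zero_le
    _ = _ := by
        rw [setLIntegral_const]; simp

/-- measure of small closed ball -/
def vb (d : ℕ) (l : ℝ) : ℝ := volume.real (Metric.closedBall (0 : Ed d) l)

lemma vb_eq (x : Ed d) (l : ℝ) : volume (Metric.closedBall x l) = ENNReal.ofReal (vb d l) := by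
  rw [Measure.addHaar_closedBall_center, vb, ofReal_measureReal (h := measure_closedBall_lt_top.ne)]

lemma poin_aux (hp : 1 ≤ p) {h : Ed d → ℝ} (hh : ContDiff ℝ 1 h) (x0 : Ed d) {r l t θ : ℝ}
    (hl : 0 ≤ l)
    (hm : ∀ x ∈ Metric.closedBall x0 r,
      ENNReal.ofReal θ ≤ volume {y | y ∈ Metric.closedBall x l ∧ h y ≤ t}) :
    ENNReal.ofReal θ * ∫⁻ x in Metric.closedBall x0 r, ENNReal.ofReal ((max (h x - t) 0) ^ p) ≤
      ENNReal.ofReal (vb d l * l ^ p) *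
        ∫⁻ x in Metric.closedBall x0 (r + l), ENNReal.ofReal (‖fderiv ℝ h x‖ ^ p) := by
  have hp0 : 0 < p := by linarith
  have hhc := hh.continuous
  set I := ∫⁻ x in Metric.closedBall x0 (r + l), ENNReal.ofReal (‖fderiv ℝ h x‖ ^ p) with hI
  have hJ : Continuous (Function.uncurry fun (x z : Ed d) => ENNReal.ofReal (|h (x + z) - h x| ^ p)) := by
    apply ENNReal.continuous_ofReal.comp
    apply Continuous.rpow_const _ (fun _ => Or.inr hp0.le)
    exact ((hhc.comp (by fun_prop)).sub (hhc.comp (by fun_prop))).abs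
  calc _ = ∫⁻ x in Metric.closedBall x0 r, ENNReal.ofReal θ * ENNReal.ofReal ((max (h x - t) 0) ^ p) := by
        rw [lintegral_const_mul' _ _ ENNReal.ofReal_ne_top]
    _ ≤ ∫⁻ x in Metric.closedBall x0 r, ∫⁻ z in Metric.closedBall 0 l, ENNReal.ofReal (|h (x + z) - h x| ^ p) := by
        apply setLIntegral_mono' measurableSet_closedBall
        intro x hx
        set S := {y | y ∈ Metric.closedBall x l ∧ h y ≤ t} with hS
        have hSm : MeasurableSet S :=
          measurableSet_closedBall.inter (measurableSet_le hhc.measurable measurable_const)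
        calc _ ≤ volume S * ENNReal.ofReal ((max (h x - t) 0) ^ p) := by gcongr; exact hm x hx
          _ = ∫⁻ y, S.indicator (fun _ => ENNReal.ofReal ((max (h x - t) 0) ^ p)) y := by
            rw [lintegral_indicator hSm, setLIntegral_const, mul_comm]
          _ = ∫⁻ z, S.indicator (fun _ => ENNReal.ofReal ((max (h x - t) 0) ^ p)) (x + z) := by
            rw [lintegral_add_left_eq_self]
          _ ≤ _ := by
            rw [← lintegral_indicator measurableSet_closedBall]
            apply lintegral_mono
            intro z
            by_cases hz : x + z ∈ S
            · have hz2 : z ∈ Metric.closedBall (0 : Ed d) l := by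
                have := hz.1
                rw [Metric.mem_closedBall, dist_eq_norm] at this ⊢
                simpa using this
              simp only [Set.indicator_of_mem hz, Set.indicator_of_mem hz2]
              apply ENNReal.ofReal_le_ofReal
              apply Real.rpow_le_rpow (le_max_right _ _) _ hp0.le
              apply max_le _ (abs_nonneg _)
              rw [abs_sub_comm]
              refine le_trans ?_ (le_abs_self _)
              have := hz.2
              linarith
            · simp only [Set.indicator_of_notMem hz]; exact zero_le
    _ = ∫⁻ z in Metric.closedBall 0 l, ∫⁻ x in Metric.closedBall x0 r, ENNReal.ofReal (|h (x + z) - h x| ^ p) := by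
        rw [lintegral_lintegral_swap hJ.measurable.aemeasurable]
    _ ≤ ∫⁻ z in Metric.closedBall (0 : Ed d) l, ENNReal.ofReal (l ^ p) * I := by
        apply setLIntegral_mono' measurableSet_closedBall
        intro z hz
        exact transl hp hh x0 z (by simpa using hz)
    _ = _ := by
        rw [setLIntegral_const, vb_eq, ENNReal.ofReal_mul (by unfold vb; positivity)]; ring

lemma cont_intOn {g : Ed d → ℝ} (hg : Continuous g) (x0 : Ed d) (r : ℝ) :
    IntegrableOn g (Metric.closedBall x0 r) :=
  hg.continuousOn.integrableOn_compact (isCompact_closedBall _ _)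

/-- Poincaré type inequality -/
lemma poin (hp : 1 ≤ p) {h : Ed d → ℝ} (hh : ContDiff ℝ 1 h) (x0 : Ed d) {r l t θ : ℝ}
    (hl : 0 ≤ l) (hθ : 0 ≤ θ)
    (hm : ∀ x ∈ Metric.closedBall x0 r,
      ENNReal.ofReal θ ≤ volume {y | y ∈ Metric.closedBall x l ∧ h y ≤ t}) :
    θ * ∫ x in Metric.closedBall x0 r, (max (h x - t) 0) ^ p ≤
      vb d l * l ^ p * ∫ x in Metric.closedBall x0 (r + l), ‖fderiv ℝ h x‖ ^ p := by
  have hp0 : 0 < p := by linarith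
  have hdc : Continuous (fderiv ℝ h) := hh.continuous_fderiv (by simp)
  have h1 := poin_aux hp hh x0 hl hm
  have c1 : Continuous fun x => (max (h x - t) 0) ^ p :=
    Continuous.rpow_const ((hh.continuous.sub continuous_const).max continuous_const) (fun _ => Or.inr hp0.le)
  have c2 : Continuous fun x => ‖fderiv ℝ h x‖ ^ p := hdc.norm.rpow_const (fun _ => Or.inr hp0.le)
  have hvb : 0 ≤ vb d l := by unfold vb; positivity
  have n1 : ∀ x, 0 ≤ (max (h x - t) 0) ^ p := fun x => Real.rpow_nonneg (le_max_right _ _) _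
  rw [← ofReal_integral_eq_lintegral_ofReal (cont_intOn c1 x0 r) (Eventually.of_forall n1),
    ← ofReal_integral_eq_lintegral_ofReal (cont_intOn c2 x0 (r+l)) (Eventually.of_forall fun x => by positivity),
    ← ENNReal.ofReal_mul hθ, ← ENNReal.ofReal_mul (by positivity)] at h1
  refine (ENNReal.ofReal_le_ofReal_iff ?_).1 h1
  have : 0 ≤ ∫ x in Metric.closedBall x0 (r + l), ‖fderiv ℝ h x‖ ^ p := integral_nonneg fun x => by positivity
  positivity




lemma sT_deriv_bdd : ∃ C, 0 < C ∧ ∀ y, |deriv Real.smoothTransition y| ≤ C := by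
  have hc : Continuous (deriv Real.smoothTransition) :=
    (Real.smoothTransition.contDiff (n := 1)).continuous_deriv (by simp)
  have hs : HasCompactSupport (deriv Real.smoothTransition) := by
    apply HasCompactSupport.intro (isCompact_Icc (a := (0:ℝ)) (b := 1))
    intro y hy
    rw [Set.mem_Icc, not_and_or, not_le, not_le] at hy
    rcases hy with hy | hy
    · have : Real.smoothTransition =ᶠ[𝓝 y] fun _ => 0 := by
        filter_upwards [Iio_mem_nhds hy] with z hz
        exact Real.smoothTransition.zero_of_nonpos (le_of_lt hz)
      rw [this.deriv_eq]; simp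
    · have : Real.smoothTransition =ᶠ[𝓝 y] fun _ => 1 := by
        filter_upwards [Ioi_mem_nhds hy] with z hz
        exact Real.smoothTransition.one_of_one_le (le_of_lt hz)
      rw [this.deriv_eq]; simp
  obtain ⟨C, hC⟩ := hc.bounded_above_of_compact_support hs
  exact ⟨max C 1, by positivity, fun y => (hC y).trans (le_max_left _ _)⟩

/-- cutoff functions -/
structure IsCut (χ : Ed d → ℝ) (x0 : Ed d) (r r' G : ℝ) : Prop where
  smooth : ContDiff ℝ (⊤ : ℕ∞) χ
  nonneg : ∀ x, 0 ≤ χ x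
  le_one : ∀ x, χ x ≤ 1
  one : ∀ x ∈ Metric.closedBall x0 r, χ x = 1
  supp : tsupport χ ⊆ Metric.closedBall x0 r'
  bd : ∀ x, ‖fderiv ℝ χ x‖ ≤ G

lemma IsCut.zero {χ : Ed d → ℝ} {x0 : Ed d} {r r' G : ℝ} (h : IsCut χ x0 r r' G) {x : Ed d}
    (hx : x ∉ Metric.closedBall x0 r') : χ x = 0 :=
  image_eq_zero_of_notMem_tsupport (fun h1 => hx (h.supp h1))

lemma IsCut.fzero {χ : Ed d → ℝ} {x0 : Ed d} {r r' G : ℝ} (h : IsCut χ x0 r r' G) {x : Ed d}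
    (hx : x ∉ Metric.closedBall x0 r') : fderiv ℝ χ x = 0 :=
  image_eq_zero_of_notMem_tsupport (fun h1 => hx (h.supp (tsupport_fderiv_subset ℝ h1)))

lemma IsCut.compact {χ : Ed d → ℝ} {x0 : Ed d} {r r' G : ℝ} (h : IsCut χ x0 r r' G) :
    HasCompactSupport χ :=
  (isCompact_closedBall x0 r').of_isClosed_subset (isClosed_tsupport _) h.supp

lemma IsCut.Gnn {χ : Ed d → ℝ} {x0 : Ed d} {r r' G : ℝ} (h : IsCut χ x0 r r' G) : 0 ≤ G :=
  (norm_nonneg _).trans (h.bd x0)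

lemma exists_cut : ∃ C0, 0 < C0 ∧ ∀ (d : ℕ) (x0 : Ed d) (r r' : ℝ), 0 < r → r < r' →
    ∃ χ, IsCut χ x0 r r' (C0 / (r' - r)) := by
  obtain ⟨C, hC, hCb⟩ := sT_deriv_bdd
  refine ⟨2 * C, by positivity, fun d x0 r r' hr hrr => ?_⟩
  have hD : 0 < r' ^ 2 - r ^ 2 := by nlinarith
  set Φ : Ed d → ℝ := fun x => (r' ^ 2 - ‖x - x0‖ ^ 2) / (r' ^ 2 - r ^ 2) with hΦ
  have hΦs : ContDiff ℝ (⊤ : ℕ∞) Φ := by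
    have : ContDiff ℝ (⊤ : ℕ∞) fun x : Ed d => ‖x - x0‖ ^ 2 :=
      (contDiff_id.sub contDiff_const).norm_sq ℝ
    exact (contDiff_const.sub this).div_const _
  set χ : Ed d → ℝ := fun x => Real.smoothTransition (Φ x) with hχ
  have hs : ContDiff ℝ (⊤ : ℕ∞) χ := Real.smoothTransition.contDiff.comp hΦs
  have hsupp : tsupport χ ⊆ Metric.closedBall x0 r' := by
    apply closure_minimal _ Metric.isClosed_closedBall
    intro x hx
    by_contra hx2
    apply hx
    rw [Metric.mem_closedBall, dist_eq_norm, not_le] at hx2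
    apply Real.smoothTransition.zero_of_nonpos
    apply div_nonpos_of_nonpos_of_nonneg _ hD.le
    nlinarith
  refine ⟨χ, hs, fun x => Real.smoothTransition.nonneg _, fun x => Real.smoothTransition.le_one _,
    ?_, hsupp, ?_⟩
  · intro x hx
    rw [Metric.mem_closedBall, dist_eq_norm] at hx
    apply Real.smoothTransition.one_of_one_le
    rw [hΦ, le_div_iff₀ hD]
    have := norm_nonneg (x - x0)
    nlinarith
  · intro x
    by_cases hx : x ∈ Metric.closedBall x0 r'
    · have hx' := hx
      rw [Metric.mem_closedBall, dist_eq_norm] at hx'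
      have h1 : HasFDerivAt (fun x : Ed d => ‖x - x0‖ ^ 2) (2 • (innerSL ℝ (x - x0))) x := by
        simpa using ((hasFDerivAt_id x).sub_const x0).norm_sq
      have h2 : HasFDerivAt Φ ((r' ^ 2 - r ^ 2)⁻¹ • (-(2 • (innerSL ℝ (x - x0)) : Ed d →L[ℝ] ℝ))) x := by
        have := (h1.const_sub (r' ^ 2)).mul_const ((r' ^ 2 - r ^ 2)⁻¹)
        simpa [hΦ, div_eq_mul_inv] using this
      have h3 : HasDerivAt Real.smoothTransition (deriv Real.smoothTransition (Φ x)) (Φ x) :=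
        ((Real.smoothTransition.contDiff (n := 1)).differentiable (by simp) _).hasDerivAt
      have h4 := h3.comp_hasFDerivAt x h2
      rw [show χ = Real.smoothTransition ∘ Φ from rfl, h4.fderiv, norm_smul, norm_smul, norm_neg,
        Real.norm_eq_abs, Real.norm_eq_abs, abs_inv, abs_of_pos hD]
      have h5 : ‖(2 • (innerSL ℝ (x - x0)) : Ed d →L[ℝ] ℝ)‖ ≤ 2 * r' := by
        rw [two_smul]
        refine (norm_add_le _ _).trans ?_
        rw [innerSL_apply_norm]; linarith
      calc |deriv Real.smoothTransition (Φ x)| * ((r' ^ 2 - r ^ 2)⁻¹ * ‖(2 • (innerSL ℝ (x - x0)) : Ed d →L[ℝ] ℝ)‖)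
          ≤ C * ((r' ^ 2 - r ^ 2)⁻¹ * (2 * r')) := by
            gcongr
            exact hCb _
        _ ≤ 2 * C / (r' - r) := by
            have e : r' ^ 2 - r ^ 2 = (r' - r) * (r' + r) := by ring
            have hr1 : 0 < r' - r := by linarith
            have hr2 : 0 < r' + r := by linarith
            rw [e, le_div_iff₀ hr1]
            have : C * (((r' - r) * (r' + r))⁻¹ * (2 * r')) * (r' - r) = 2 * C * (r' / (r' + r)) := by
              field_simp
            rw [this]
            have : r' / (r' + r) ≤ 1 := by rw [div_le_one hr2]; linarith
            nlinarith
    · have : fderiv ℝ χ x = 0 :=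
        image_eq_zero_of_notMem_tsupport (fun h1 => hx (hsupp (tsupport_fderiv_subset ℝ h1)))
      rw [this, norm_zero]
      have : 0 < r' - r := by linarith
      positivity

/-- pointwise convexity inequality -/
lemma pt_conv (hp : 1 ≤ p) {l A B w : ℝ} (h0 : 0 ≤ l) (h1 : l ≤ 1) (hA : 0 ≤ A) (hB : 0 ≤ B)
    (hw : 0 ≤ w) (hBw : l = 0 → B = 0) (hw2 : 0 < l → l * (B / l) ^ p ≤ w) :
    ((1 - l) * A + B) ^ p ≤ (1 - l) * A ^ p + w := by
  rcases h0.eq_or_lt with h | h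
  · rw [hBw h.symm, ← h]; simpa using hw
  · have := conv_pow hp h0 h1 hA (div_nonneg hB h0)
    rw [mul_div_cancel₀ _ h.ne'] at this
    linarith [hw2 h]

lemma pow_div_rpow_le (hp : 0 < p) {c : ℝ} (h0 : 0 < c) (h1 : c ≤ 1) {m : ℕ} (hm : p ≤ m) :
    c ^ m / c ^ p ≤ 1 := by
  rw [div_le_one (by positivity), ← Real.rpow_natCast]
  exact Real.rpow_le_rpow_of_exponent_ge h0 h1 hm

lemma cacc_pt (hp : 1 ≤ p) {m : ℕ} (hm : p ≤ m) (hm2 : 2 ≤ m) {c A w : ℝ} (h0 : 0 ≤ c) (h1 : c ≤ 1)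
    (hA : 0 ≤ A) (hw : 0 ≤ w) :
    ((1 - c ^ m) * A + m * c ^ (m - 1) * w) ^ p ≤ (1 - c ^ m) * A ^ p + (m * w) ^ p := by
  have hp0 : 0 < p := by linarith
  apply pt_conv hp (by positivity) (pow_le_one₀ h0 h1) hA (by positivity) (by positivity)
  · intro h
    have : c = 0 := by simpa [show m ≠ 0 by omega] using h
    rw [this, zero_pow (by omega)]; simp
  · intro h
    have hc : 0 < c := by
      rcases h0.eq_or_lt with h' | h'
      · rw [← h', zero_pow (by omega)] at h; exact absurd h (lt_irrefl _)
      · exact h'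
    have e : m * c ^ (m - 1) * w / c ^ m = (m * w) / c := by
      have : c ^ m = c ^ (m - 1) * c := by rw [← pow_succ]; congr 1; omega
      rw [this]; field_simp
    rw [e, Real.div_rpow (by positivity) h0]
    have := pow_div_rpow_le hp0 hc h1 hm
    calc c ^ m * ((m * w) ^ p / c ^ p) = (c ^ m / c ^ p) * (m * w) ^ p := by ring
      _ ≤ 1 * (m * w) ^ p := by gcongr
      _ = _ := one_mul _

lemma test_mul (hu : IsTestOn Ω u) {g : Ed d → ℝ} (hg : ContDiff ℝ (⊤ : ℕ∞) g) :
    IsTestOn Ω (fun x => g x * u x) := by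
  refine ⟨hg.mul hu.1, ?_, ?_⟩
  · exact hu.2.1.mul_left
  · exact (tsupport_mul_subset_right).trans hu.2.2

lemma ind_cont_int {g : Ed d → ℝ} (hg : Continuous g) (x0 : Ed d) (r : ℝ) :
    Integrable ((Metric.closedBall x0 r).indicator g) :=
  (integrable_indicator_iff measurableSet_closedBall).2 (cont_intOn hg x0 r)

lemma cacc (hp : 1 < p) (hV : LocBddOn Ω V) (hQ : NonnegOn p Ω V) (hu : IsTestOn Ω u)
    {χ : Ed d → ℝ} {x0 : Ed d} {r r' G M : ℝ} (hχ : IsCut χ x0 r r' G)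
    (hM : ∀ᵐ x, x ∈ Metric.closedBall x0 r' → |V x| ≤ M)
    {m : ℕ} (hm : p ≤ m) (hm2 : 2 ≤ m) :
    ∫ x, χ x ^ m * ‖fderiv ℝ u x‖ ^ p ≤ Qp p Ω V u +
      ((m * G) ^ p + M) * ∫ x in Metric.closedBall x0 r', |u x| ^ p := by
  have hp0 : 0 < p := by linarith
  have hG := hχ.Gnn
  set f : Ed d → ℝ := fun x => (1 - χ x ^ m) * u x with hf
  have hfs : IsTestOn Ω f := test_mul hu (contDiff_const.sub (hχ.smooth.pow m))
  have hcu : Continuous fun x => |u x| ^ p := (abs_rpow_supp hp0 hu).1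
  rw [← integral_const_mul, ← integral_indicator measurableSet_closedBall]
  refine cmp hp0 hV hQ hu hfs ?_ (ind_cont_int (continuous_const.mul hcu) x0 r') ?_
  · refine (int_grad hp0 hu).bdd_mul (c := 1) ((hχ.smooth.continuous.pow m).aestronglyMeasurable) ?_
    refine Eventually.of_forall fun x => ?_
    rw [Real.norm_eq_abs, abs_of_nonneg (pow_nonneg (hχ.nonneg x) _)]
    exact pow_le_one₀ (hχ.nonneg x) (hχ.le_one x)
  · filter_upwards [hM] with x hMx
    have hd : fderiv ℝ f x = (1 - χ x ^ m) • fderiv ℝ u x - (m * χ x ^ (m - 1) * u x) • fderiv ℝ χ x := by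
      have h1 : HasFDerivAt χ (fderiv ℝ χ x) x := (hχ.smooth.differentiable (by simp) x).hasFDerivAt
      have h2 : HasFDerivAt u (fderiv ℝ u x) x := (test_diff hu x).hasFDerivAt
      have h3 := ((h1.pow m).const_sub 1).mul h2
      rw [show f = (fun x => 1 - χ x ^ m) * u from rfl, h3.fderiv]
      ext y; simp; ring
    have hc0 := hχ.nonneg x
    have hc1 := hχ.le_one x
    have hz0 : 0 ≤ 1 - χ x ^ m := sub_nonneg.2 (pow_le_one₀ hc0 hc1)
    have hz1 : 1 - χ x ^ m ≤ 1 := by have := pow_nonneg hc0 m; linarith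
    have hn : ‖fderiv ℝ f x‖ ^ p ≤ (1 - χ x ^ m) * ‖fderiv ℝ u x‖ ^ p + (m * (|u x| * ‖fderiv ℝ χ x‖)) ^ p := by
      refine le_trans (Real.rpow_le_rpow (norm_nonneg _) ?_ hp0.le) (cacc_pt hp.le hm hm2 hc0 hc1 (norm_nonneg _) (by positivity))
      rw [hd]
      refine (norm_sub_le _ _).trans ?_
      rw [norm_smul, norm_smul, norm_mul, Real.norm_of_nonneg hz0, Real.norm_of_nonneg (by positivity), Real.norm_eq_abs]
      apply le_of_eq; ring
    have hfx : |f x| = (1 - χ x ^ m) * |u x| := by rw [hf, abs_mul, abs_of_nonneg hz0]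
    by_cases hx : x ∈ Metric.closedBall x0 r'
    · rw [Set.indicator_of_mem hx]
      have h1 : (m * (|u x| * ‖fderiv ℝ χ x‖)) ^ p ≤ (m * G) ^ p * |u x| ^ p := by
        rw [← Real.mul_rpow (by positivity) (abs_nonneg _)]
        apply Real.rpow_le_rpow (by positivity) _ hp0.le
        have := hχ.bd x
        calc m * (|u x| * ‖fderiv ℝ χ x‖) ≤ m * (|u x| * G) := by gcongr
          _ = _ := by ring
      have h2 : V x * |f x| ^ p ≤ V x * |u x| ^ p + M * |u x| ^ p := by
        rw [hfx, Real.mul_rpow hz0 (abs_nonneg _)]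
        have h3 : (1 - χ x ^ m) ^ p ≤ 1 := Real.rpow_le_one hz0 hz1 hp0.le
        have h4 : 0 ≤ (1 - χ x ^ m) ^ p := Real.rpow_nonneg hz0 _
        have h5 : 0 ≤ |u x| ^ p := by positivity
        have h6 := abs_le.1 (hMx hx)
        have h7 : 0 ≤ M := (abs_nonneg _).trans (hMx hx)
        have : V x * (1 - χ x ^ m) ^ p ≤ V x + M := by nlinarith
        nlinarith
      linarith
    · rw [Set.indicator_of_notMem hx]
      have hc : χ x ^ m = 0 := by rw [hχ.zero hx, zero_pow (by omega)]
      rw [hχ.fzero hx, norm_zero, mul_zero, mul_zero, Real.zero_rpow hp0.ne'] at hn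
      rw [hfx]
      rw [hc] at hn ⊢
      simp at hn ⊢
      linarith

/-- Caccioppoli in final form -/
lemma cacc2 (hp : 1 < p) (hV : LocBddOn Ω V) (hQ : NonnegOn p Ω V) :
    ∃ K : ℝ, 0 < K ∧ ∀ (x0 : Ed d) (r r' M : ℝ), 0 < r → r < r' →
      (∀ᵐ x, x ∈ Metric.closedBall x0 r' → |V x| ≤ M) → ∀ u, IsTestOn Ω u →
      ∫ x in Metric.closedBall x0 r, ‖fderiv ℝ u x‖ ^ p ≤ Qp p Ω V u +
        ((K / (r' - r)) ^ p + M) * ∫ x in Metric.closedBall x0 r', |u x| ^ p := by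
  have hp0 : 0 < p := by linarith
  obtain ⟨C0, hC0, hcut⟩ := exists_cut
  obtain ⟨m, hm⟩ := exists_nat_ge (p + 2)
  have hmp : p ≤ m := by linarith
  have hm2 : 2 ≤ m := by have : (2:ℝ) ≤ m := by linarith
                         exact_mod_cast this
  have hm0 : (0:ℝ) < m := by linarith
  refine ⟨m * C0, by positivity, fun x0 r r' M hr hrr hM u hu => ?_⟩
  obtain ⟨χ, hχ⟩ := hcut d x0 r r' hr hrr
  have h := cacc hp hV hQ hu hχ hM hmp hm2
  rw [mul_div_assoc]
  refine le_trans ?_ h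
  rw [← integral_indicator measurableSet_closedBall]
  apply integral_mono_of_nonneg
  · exact Eventually.of_forall fun x => Set.indicator_nonneg (fun y _ => by positivity) x
  · refine (int_grad hp0 hu).bdd_mul (c := 1) ((hχ.smooth.continuous.pow m).aestronglyMeasurable) ?_
    refine Eventually.of_forall fun x => ?_
    rw [Real.norm_eq_abs, abs_of_nonneg (pow_nonneg (hχ.nonneg x) _)]
    exact pow_le_one₀ (hχ.nonneg x) (hχ.le_one x)
  · refine Eventually.of_forall fun x => ?_
    by_cases hx : x ∈ Metric.closedBall x0 r
    · simp [Set.indicator_of_mem hx, hχ.one x hx]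
    · simp only [Set.indicator_of_notMem hx]
      have := hχ.nonneg x
      positivity




/-- logarithmic function -/
def Hh (A t : ℝ) : ℝ := A + Real.log (1 + t)

lemma Hh_ge {A t : ℝ} (ht : 0 ≤ t) : A ≤ Hh A t := by
  have := Real.log_nonneg (show (1:ℝ) ≤ 1 + t by linarith)
  unfold Hh; linarith

lemma Hh_pow_le {A q : ℝ} (hA : 1 ≤ A) (hq : 0 ≤ q) :
    ∃ C, 1 ≤ C ∧ ∀ t, 0 ≤ t → Hh A t ^ q ≤ C * (1 + t) := by
  refine ⟨(A + q + 1) ^ q, Real.one_le_rpow (by linarith) hq, fun t ht => ?_⟩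
  have h1 : (1:ℝ) ≤ 1 + t := by linarith
  set ε := 1 / (q + 1) with hε
  have hε0 : 0 < ε := by positivity
  have h2 := Real.log_le_rpow_div (show (0:ℝ) ≤ 1 + t by linarith) hε0
  have h3 : (1 + t) ^ ε / ε = (q + 1) * (1 + t) ^ ε := by rw [hε]; field_simp
  have h4 : (1:ℝ) ≤ (1 + t) ^ ε := Real.one_le_rpow h1 hε0.le
  have h5 : Hh A t ≤ (A + q + 1) * (1 + t) ^ ε := by
    unfold Hh; rw [h3] at h2; nlinarith
  calc Hh A t ^ q ≤ ((A + q + 1) * (1 + t) ^ ε) ^ q :=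
        Real.rpow_le_rpow (by linarith [Hh_ge (A := A) ht]) h5 hq
    _ = (A + q + 1) ^ q * (1 + t) ^ (ε * q) := by
        rw [Real.mul_rpow (by linarith) (by positivity), Real.rpow_mul (by linarith)]
    _ ≤ (A + q + 1) ^ q * (1 + t) ^ (1:ℝ) := by
        gcongr
        rw [hε, one_div_mul_eq_div, div_le_one (by positivity)]; linarith
    _ = _ := by rw [Real.rpow_one]

/-- the test nonlinearity -/
def gg (p A q t : ℝ) : ℝ := Hh A t ^ q * (1 + t) ^ (1 - p)

def kk (p A q t : ℝ) : ℝ := ((p - 1) * Hh A t - q) * Hh A t ^ (q - 1) * (1 + t) ^ (-p)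

lemma gg_deriv {A q t : ℝ} (hA : 1 ≤ A) (ht : 0 ≤ t) :
    HasDerivAt (gg p A q) (-kk p A q t) t := by
  have h1 : 0 < 1 + t := by linarith
  have hH : 0 < Hh A t := by linarith [Hh_ge (A := A) ht]
  have e0 : HasDerivAt (fun t : ℝ => 1 + t) 1 t := (hasDerivAt_id t).const_add 1
  have e1 : HasDerivAt (Hh A) ((1 + t)⁻¹) t := by
    have := (e0.log h1.ne').const_add A
    exact (by simpa using this : HasDerivAt (fun x => A + Real.log (1 + x)) ((1 + t)⁻¹) t)
  have e2 := e1.rpow_const (p := q) (Or.inl hH.ne')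
  have e3 := e0.rpow_const (p := 1 - p) (Or.inl h1.ne')
  have e4 := e2.mul e3
  refine e4.congr_deriv ?_
  unfold kk
  have f1 : Hh A t ^ q = Hh A t ^ (q - 1) * Hh A t := by
    rw [← Real.rpow_add_one hH.ne']; congr 1; ring
  have f2 : (1 + t) ^ (1 - p - 1) = (1 + t) ^ (-p) := by congr 1; ring
  have f3 : (1 + t) ^ (1 - p) = (1 + t) ^ (-p) * (1 + t) := by
    rw [← Real.rpow_add_one h1.ne']; congr 1; ring
  rw [f1, f2, f3]
  field_simp
  ring

lemma kk_bounds {A q t : ℝ} (hp : 1 < p) (hA : 1 ≤ A) (hq : 0 ≤ q) (hAq : 2 * q ≤ (p - 1) * A) (ht : 0 ≤ t) :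
    (p - 1) / 2 * (Hh A t ^ q * (1 + t) ^ (-p)) ≤ kk p A q t ∧
    kk p A q t ≤ (p - 1) * (Hh A t ^ q * (1 + t) ^ (-p)) := by
  have h1 : 0 < 1 + t := by linarith
  have hH : 0 < Hh A t := by linarith [Hh_ge (A := A) ht]
  have f1 : Hh A t ^ q = Hh A t ^ (q - 1) * Hh A t := by
    rw [← Real.rpow_add_one hH.ne']; congr 1; ring
  have hX : 0 < Hh A t ^ (q - 1) * (1 + t) ^ (-p) := by positivity
  have h2 : 2 * q ≤ (p - 1) * Hh A t :=
    hAq.trans (mul_le_mul_of_nonneg_left (Hh_ge ht) (by linarith))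
  unfold kk
  rw [f1]
  constructor
  · have : (p - 1) / 2 * Hh A t ≤ (p - 1) * Hh A t - q := by linarith
    calc _ = (p - 1) / 2 * Hh A t * (Hh A t ^ (q - 1) * (1 + t) ^ (-p)) := by ring
      _ ≤ ((p - 1) * Hh A t - q) * (Hh A t ^ (q - 1) * (1 + t) ^ (-p)) := by gcongr
      _ = _ := by ring
  · have : (p - 1) * Hh A t - q ≤ (p - 1) * Hh A t := by linarith
    calc _ = ((p - 1) * Hh A t - q) * (Hh A t ^ (q - 1) * (1 + t) ^ (-p)) := by ring
      _ ≤ ((p - 1) * Hh A t) * (Hh A t ^ (q - 1) * (1 + t) ^ (-p)) := by gcongr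
      _ = _ := by ring

/-- convexity upper bound for a difference of powers -/
lemma rpow_sub_le (hp : 1 < p) {a b : ℝ} (ha : 0 ≤ a) (hab : a ≤ b) :
    b ^ p - a ^ p ≤ p * b ^ (p - 1) * (b - a) := by
  rcases hab.eq_or_lt with h | h
  · rw [h]; simp
  · have hb : 0 < b := by linarith
    have := one_add_mul_self_le_rpow_one_add (s := a / b - 1) (by have : 0 ≤ a / b := by positivity
                                                                  linarith) hp.le
    rw [add_sub_cancel, Real.div_rpow ha hb.le, le_div_iff₀ (by positivity)] at this
    have e : b ^ p = b ^ (p - 1) * b := by rw [← Real.rpow_add_one hb.ne']; congr 1; ring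
    have : (1 + p * (a / b - 1)) * b ^ p = b ^ p + p * b ^ (p - 1) * (a - b) := by
      rw [e]; field_simp
    nlinarith

lemma moser_pt (hp : 1 < p) {A q C c : ℝ} (hA : 1 ≤ A) (hq : 0 ≤ q) (hAq : 2 * q ≤ (p - 1) * A)
    (hC1 : 1 ≤ C) (hC : ∀ t, 0 ≤ t → Hh A t ^ q ≤ C * (1 + t)) (hc : c = 1 / (p * C))
    {m : ℕ} (hm : p ≤ m) (hm2 : 2 ≤ m) {t χ a w G : ℝ} (ht : 0 ≤ t) (h0 : 0 ≤ χ) (h1 : χ ≤ 1) (ha : 0 ≤ a)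
    (hw : 0 ≤ w) (hwG : w ≤ G) :
    0 ≤ 1 - c * χ ^ m * kk p A q t ∧
    c * ((p - 1) / 2 * (χ ^ m * (Hh A t ^ q * (a / (1 + t)) ^ p))) +
      ((1 - c * χ ^ m * kk p A q t) * a + c * (m * χ ^ (m - 1) * gg p A q t * w)) ^ p ≤
      a ^ p + c * ((p - 1) * (2 * m / (p - 1) * G) ^ p) * Hh A t ^ q := by
  have hp0 : 0 < p := by linarith
  have hp1 : 0 < p - 1 := by linarith
  have ht1 : 0 < 1 + t := by linarith
  have hH : 0 < Hh A t := by linarith [Hh_ge (A := A) ht]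
  have hc0 : 0 < c := by rw [hc]; positivity
  obtain ⟨k1, k2⟩ := kk_bounds hp hA hq hAq ht
  set X := Hh A t ^ q with hX
  have hX0 : 0 < X := by positivity
  have hk0 : 0 < kk p A q t := lt_of_lt_of_le (by positivity) k1
  have hχm : χ ^ m ≤ 1 := pow_le_one₀ h0 h1
  have hck : c * kk p A q t ≤ 1 := by
    have e1 : X * (1 + t) ^ (-p) ≤ C := by
      calc X * (1 + t) ^ (-p) ≤ (C * (1 + t)) * (1 + t) ^ (-(1:ℝ)) := by
            gcongr
            · exact hC t ht
            · linarith
        _ = C := by rw [Real.rpow_neg_one]; field_simp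
    calc c * kk p A q t ≤ c * ((p - 1) * C) := by
          refine mul_le_mul_of_nonneg_left (k2.trans ?_) hc0.le
          gcongr
      _ = (p - 1) / p := by rw [hc]; field_simp
      _ ≤ 1 := by rw [div_le_one hp0]; linarith
  have hl0 : 0 ≤ c * χ ^ m * kk p A q t := by positivity
  have hl1 : c * χ ^ m * kk p A q t ≤ 1 := by
    calc _ = χ ^ m * (c * kk p A q t) := by ring
      _ ≤ 1 * 1 := by gcongr
      _ = 1 := one_mul _
  refine ⟨by linarith, ?_⟩
  have hg0 : 0 < gg p A q t := by unfold gg; positivity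
  have key := pt_conv (p := p) hp.le hl0 hl1 ha (B := c * (m * χ ^ (m - 1) * gg p A q t * w))
    (w := c * ((p - 1) * (2 * m / (p - 1) * G) ^ p) * X) (by positivity)
    (by have : 0 ≤ G := hw.trans hwG
        positivity) ?_ ?_
  · have : c * ((p - 1) / 2 * (χ ^ m * (X * (a / (1 + t)) ^ p))) ≤ c * χ ^ m * kk p A q t * a ^ p := by
      have e : (a / (1 + t)) ^ p = a ^ p * (1 + t) ^ (-p) := by
        rw [Real.div_rpow ha ht1.le, Real.rpow_neg ht1.le]; rfl
      rw [e]
      calc _ = c * χ ^ m * ((p - 1) / 2 * (X * (1 + t) ^ (-p))) * a ^ p := by ring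
        _ ≤ _ := by gcongr
    linarith
  · intro h
    have : χ = 0 := by
      by_contra hne
      have : 0 < χ := lt_of_le_of_ne h0 (Ne.symm hne)
      have : 0 < c * χ ^ m * kk p A q t := by positivity
      linarith
    rw [this, zero_pow (by omega)]; simp
  · intro h
    have hχ : 0 < χ := by
      rcases h0.eq_or_lt with h' | h'
      · rw [← h', zero_pow (by omega)] at h; simp at h
      · exact h'
    have e1 : c * (m * χ ^ (m - 1) * gg p A q t * w) / (c * χ ^ m * kk p A q t) ≤
        (2 * m / (p - 1) * G) * (1 + t) / χ := by
      rw [div_le_iff₀ h]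
      have e2 : χ ^ m = χ ^ (m - 1) * χ := by rw [← pow_succ]; congr 1; omega
      have e3 : gg p A q t = (X * (1 + t) ^ (-p)) * (1 + t) := by
        unfold gg; rw [mul_assoc, ← Real.rpow_add_one ht1.ne']; congr 2; ring
      have e4 : X * (1 + t) ^ (-p) ≤ 2 / (p - 1) * kk p A q t := by
        rw [div_mul_eq_mul_div, le_div_iff₀ hp1]; linarith
      calc c * (m * χ ^ (m - 1) * gg p A q t * w) = c * (m * χ ^ (m - 1) * ((X * (1 + t) ^ (-p)) * (1 + t)) * w) := by rw [e3]
        _ ≤ c * (m * χ ^ (m - 1) * ((2 / (p - 1) * kk p A q t) * (1 + t)) * G) := by gcongr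
        _ = _ := by rw [e2]; field_simp
    have hG : 0 ≤ G := hw.trans hwG
    calc c * χ ^ m * kk p A q t * (c * (m * χ ^ (m - 1) * gg p A q t * w) / (c * χ ^ m * kk p A q t)) ^ p
        ≤ c * χ ^ m * ((p - 1) * (X * (1 + t) ^ (-p))) * ((2 * m / (p - 1) * G) * (1 + t) / χ) ^ p := by
          gcongr
      _ = c * ((p - 1) * (2 * m / (p - 1) * G) ^ p) * X * ((1 + t) ^ (-p) * (1 + t) ^ p) * (χ ^ m / χ ^ p) := by
          rw [Real.div_rpow (by positivity) h0, Real.mul_rpow (by positivity) ht1.le]; ring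
      _ ≤ c * ((p - 1) * (2 * m / (p - 1) * G) ^ p) * X * 1 * 1 := by
          gcongr
          · rw [← Real.rpow_add ht1]; simp
          · exact pow_div_rpow_le hp0 hχ h1 hm
      _ = _ := by ring

/-- the potential term -/
lemma moser_V (hp : 1 < p) {A q C c : ℝ} (hA : 1 ≤ A)
    (hC1 : 1 ≤ C) (hC : ∀ t, 0 ≤ t → Hh A t ^ q ≤ C * (1 + t)) (hc : c = 1 / (p * C))
    {t χ : ℝ} (ht : 0 ≤ t) (h0 : 0 ≤ χ) (h1 : χ ≤ 1) :
    0 ≤ (t + c * (χ * gg p A q t)) ^ p - t ^ p ∧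
    (t + c * (χ * gg p A q t)) ^ p - t ^ p ≤ c * (p * 2 ^ (p - 1)) * Hh A t ^ q := by
  have hp0 : 0 < p := by linarith
  have ht1 : 0 < 1 + t := by linarith
  have hH : 0 < Hh A t := by linarith [Hh_ge (A := A) ht]
  have hc0 : 0 < c := by rw [hc]; positivity
  have hg0 : 0 < gg p A q t := by unfold gg; positivity
  have hle : t ≤ t + c * (χ * gg p A q t) := by have : 0 ≤ c * (χ * gg p A q t) := by positivity
                                                linarith
  have hcg : c * (χ * gg p A q t) ≤ 1 + t := by
    calc c * (χ * gg p A q t) ≤ c * (1 * (C * (1 + t) * (1 + t) ^ (0:ℝ))) := by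
          unfold gg
          gcongr
          · exact hC t ht
          · linarith
          · linarith
      _ = (1 + t) / p := by rw [hc, Real.rpow_zero]; field_simp
      _ ≤ 1 + t := by rw [div_le_iff₀ hp0]; nlinarith
  constructor
  · have := Real.rpow_le_rpow ht hle hp0.le
    linarith
  · refine (rpow_sub_le hp ht hle).trans ?_
    rw [add_sub_cancel_left]
    calc p * (t + c * (χ * gg p A q t)) ^ (p - 1) * (c * (χ * gg p A q t))
        ≤ p * (2 * (1 + t)) ^ (p - 1) * (c * (1 * gg p A q t)) := by
          gcongr
          linarith
      _ = c * (p * 2 ^ (p - 1)) * Hh A t ^ q * ((1 + t) ^ (p - 1) * (1 + t) ^ (1 - p)) := by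
          unfold gg; rw [Real.mul_rpow (by norm_num) ht1.le]; ring
      _ = _ := by rw [← Real.rpow_add ht1]; simp

lemma test_add {v : Ed d → ℝ} (hu : IsTestOn Ω u) (hv : IsTestOn Ω v) : IsTestOn Ω (fun x => u x + v x) := by
  refine ⟨hu.1.add hv.1, hu.2.1.add hv.2.1, ?_⟩
  exact (tsupport_add u v).trans (Set.union_subset hu.2.2 hv.2.2)

lemma cut_test {χ : Ed d → ℝ} {x0 : Ed d} {r r' G : ℝ} (hχ : IsCut χ x0 r r' G)
    (hb : Metric.closedBall x0 r' ⊆ Ω) {m : ℕ} (hm : 1 ≤ m) {g : Ed d → ℝ} (hg : ContDiff ℝ (⊤ : ℕ∞) g) :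
    IsTestOn Ω (fun x => χ x ^ m * g x) := by
  have h0 : IsTestOn Ω χ := ⟨hχ.smooth, hχ.compact, hχ.supp.trans hb⟩
  have := test_mul h0 ((hχ.smooth.pow (m - 1)).mul hg)
  convert this using 2 with x
  obtain ⟨k, rfl⟩ : ∃ k, m = k + 1 := ⟨m - 1, by omega⟩
  simp only [Nat.add_sub_cancel]
  ring

lemma Hh_smooth {A q : ℝ} (hA : 1 ≤ A) (hu : IsTestOn Ω u) (hu0 : ∀ x, 0 ≤ u x) :
    ContDiff ℝ (⊤ : ℕ∞) (fun x => Hh A (u x)) ∧ ContDiff ℝ (⊤ : ℕ∞) (fun x => Hh A (u x) ^ q) ∧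
     ContDiff ℝ (⊤ : ℕ∞) (fun x => gg p A q (u x)) := by
  have h1 : ContDiff ℝ (⊤ : ℕ∞) (fun x => 1 + u x) := contDiff_const.add hu.1
  have hne : ∀ x, 1 + u x ≠ 0 := fun x => by have := hu0 x; positivity
  have h2 : ContDiff ℝ (⊤ : ℕ∞) (fun x => Hh A (u x)) := contDiff_const.add (h1.log hne)
  have h3 : ContDiff ℝ (⊤ : ℕ∞) (fun x => Hh A (u x) ^ q) :=
    h2.rpow_const_of_ne (fun x => by have := Hh_ge (A := A) (hu0 x); linarith)
  exact ⟨h2, h3, h3.mul (h1.rpow_const_of_ne hne)⟩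

lemma moser (hp : 1 < p) (hV : LocBddOn Ω V) (hQ : NonnegOn p Ω V) {A q : ℝ} (hA : 1 ≤ A) (hq : 0 ≤ q)
    (hAq : 2 * q ≤ (p - 1) * A) (x0 : Ed d) {r r' : ℝ} (hr : 0 < r) (hrr : r < r')
    (hb : Metric.closedBall x0 r' ⊆ Ω) :
    ∃ C, 0 < C ∧ ∀ u, IsTestOn Ω u → (∀ x, 0 ≤ u x) →
      ∫ x in Metric.closedBall x0 r, Hh A (u x) ^ q * (‖fderiv ℝ u x‖ / (1 + u x)) ^ p ≤
        C * (Qp p Ω V u + ∫ x in Metric.closedBall x0 r', Hh A (u x) ^ q) := by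
  have hp0 : 0 < p := by linarith
  have hp1 : 0 < p - 1 := by linarith
  obtain ⟨C0, hC0, hcut⟩ := exists_cut
  obtain ⟨m, hm⟩ := exists_nat_ge (p + 2)
  have hmp : p ≤ m := by linarith
  have hm2 : 2 ≤ m := by have : (2:ℝ) ≤ m := by linarith
                         exact_mod_cast this
  have hm0 : (0:ℝ) < m := by linarith
  obtain ⟨χ, hχ⟩ := hcut d x0 r r' hr hrr
  obtain ⟨M, hM⟩ := hV.2 _ (isCompact_closedBall x0 r') hb
  set G := C0 / (r' - r) with hG
  have hG0 : 0 ≤ G := hχ.Gnn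
  obtain ⟨C, hC1, hC⟩ := Hh_pow_le hA hq
  set c := 1 / (p * C) with hc
  have hc0 : 0 < c := by positivity
  set N := c * ((p - 1) * (2 * m / (p - 1) * G) ^ p) + |M| * (c * (p * 2 ^ (p - 1))) with hN
  have hN0 : 0 ≤ N := by positivity
  refine ⟨(N + 1) / (c * ((p - 1) / 2)), by positivity, fun u hu hu0 => ?_⟩
  obtain ⟨s1, s2, s3⟩ := Hh_smooth (p := p) (q := q) hA hu hu0
  set f : Ed d → ℝ := fun x => u x + c * (χ x ^ m * gg p A q (u x)) with hf
  have hfs : IsTestOn Ω f := test_add hu (test_smul c (cut_test hχ hb (by omega) s3))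
  set E : Ed d → ℝ := fun x => Hh A (u x) ^ q * (‖fderiv ℝ u x‖ / (1 + u x)) ^ p with hE
  have hEc : Continuous E := by
    refine s2.continuous.mul (Continuous.rpow_const ?_ (fun _ => Or.inr hp0.le))
    exact (test_fcont hu).norm.div (continuous_const.add (test_cont hu)) (fun x => by have := hu0 x; positivity)
  have hE0 : ∀ x, 0 ≤ E x := fun x => by
    have h1 := hu0 x
    have := Hh_ge (A := A) (hu0 x)
    exact mul_nonneg (Real.rpow_nonneg (by linarith) _) (by positivity)
  have hFi : Integrable (fun x => χ x ^ m * E x) := by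
    apply Continuous.integrable_of_hasCompactSupport
    · exact (hχ.smooth.continuous.pow m).mul hEc
    · apply HasCompactSupport.intro (isCompact_closedBall x0 r')
      intro x hx
      rw [hχ.zero hx, zero_pow (by omega), zero_mul]
  have key : ∫ x, c * ((p - 1) / 2 * (χ x ^ m * E x)) ≤ Qp p Ω V u +
      ∫ x, (Metric.closedBall x0 r').indicator (fun x => N * Hh A (u x) ^ q) x := by
    refine cmp hp0 hV hQ hu hfs ((hFi.const_mul _).const_mul _) (ind_cont_int (continuous_const.mul s2.continuous) x0 r') ?_
    filter_upwards [hM] with x hMx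
    have hd : fderiv ℝ f x = (1 - c * χ x ^ m * kk p A q (u x)) • fderiv ℝ u x +
        (c * (m * χ x ^ (m - 1) * gg p A q (u x))) • fderiv ℝ χ x := by
      have h1 : HasFDerivAt χ (fderiv ℝ χ x) x := (hχ.smooth.differentiable (by simp) x).hasFDerivAt
      have h2 : HasFDerivAt u (fderiv ℝ u x) x := (test_diff hu x).hasFDerivAt
      have h3 := (gg_deriv (p := p) (q := q) hA (hu0 x)).comp_hasFDerivAt x h2
      have h4 := h2.add (((h1.pow m).mul h3).const_mul c)
      rw [show f = u + fun y => c * ((fun x => χ x ^ m) * gg p A q ∘ u) y from rfl, h4.fderiv]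
      ext y; simp; ring
    have hc0 := hχ.nonneg x
    have hc1 := hχ.le_one x
    have hHn : 0 ≤ Hh A (u x) ^ q := Real.rpow_nonneg (by linarith [Hh_ge (A := A) (hu0 x)]) _
    obtain ⟨l1, l2⟩ := moser_pt hp hA hq hAq hC1 hC hc hmp hm2 (hu0 x) hc0 hc1 (norm_nonneg (fderiv ℝ u x))
      (norm_nonneg _) (hχ.bd x)
    have hgp : 0 ≤ gg p A q (u x) := by
      have := hu0 x
      exact mul_nonneg hHn (by positivity)
    have hn : ‖fderiv ℝ f x‖ ≤ (1 - c * χ x ^ m * kk p A q (u x)) * ‖fderiv ℝ u x‖ +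
        c * (m * χ x ^ (m - 1) * gg p A q (u x) * ‖fderiv ℝ χ x‖) := by
      rw [hd]
      refine (norm_add_le _ _).trans ?_
      rw [norm_smul, norm_smul, Real.norm_of_nonneg l1, Real.norm_of_nonneg (by positivity)]
      apply le_of_eq; ring
    have hn2 := Real.rpow_le_rpow (norm_nonneg _) hn hp0.le
    obtain ⟨v1, v2⟩ := moser_V hp hA hC1 hC hc (hu0 x) (pow_nonneg hc0 m) (pow_le_one₀ hc0 hc1)
    have hf0 : 0 ≤ f x := by
      have := hu0 x
      rw [hf]; positivity
    by_cases hx : x ∈ Metric.closedBall x0 r'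
    · rw [Set.indicator_of_mem hx, abs_of_nonneg hf0, abs_of_nonneg (hu0 x)]
      have hV2 : V x * f x ^ p - V x * u x ^ p ≤ |M| * (c * (p * 2 ^ (p - 1))) * Hh A (u x) ^ q := by
        calc V x * f x ^ p - V x * u x ^ p = V x * (f x ^ p - u x ^ p) := by ring
          _ ≤ |M| * (f x ^ p - u x ^ p) := by
            apply mul_le_mul_of_nonneg_right _ v1
            exact (le_abs_self _).trans ((hMx hx).trans (le_abs_self _))
          _ ≤ |M| * (c * (p * 2 ^ (p - 1)) * Hh A (u x) ^ q) := mul_le_mul_of_nonneg_left v2 (abs_nonneg _)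
          _ = _ := by ring
      rw [hN]
      have : c * ((p - 1) / 2 * (χ x ^ m * E x)) = c * ((p - 1) / 2 * (χ x ^ m * (Hh A (u x) ^ q * (‖fderiv ℝ u x‖ / (1 + u x)) ^ p))) := rfl
      rw [this]
      linarith
    · rw [Set.indicator_of_notMem hx]
      have h1 : χ x = 0 := hχ.zero hx
      have h2 : f x = u x := by rw [hf]; simp [h1, show m ≠ 0 by omega]
      have h3 : fderiv ℝ f x = fderiv ℝ u x := by
        rw [hd, h1, hχ.fzero hx]; simp [show m ≠ 0 by omega]
      rw [h2, h3, h1, zero_pow (by omega)]; simp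
  rw [integral_indicator measurableSet_closedBall, integral_const_mul, integral_const_mul, integral_const_mul] at key
  have h1 : ∫ x in Metric.closedBall x0 r, E x ≤ ∫ x, χ x ^ m * E x := by
    rw [← integral_indicator measurableSet_closedBall]
    apply integral_mono_of_nonneg
    · exact Eventually.of_forall fun x => Set.indicator_nonneg (fun y _ => hE0 y) x
    · exact hFi
    · refine Eventually.of_forall fun x => ?_
      by_cases hx : x ∈ Metric.closedBall x0 r
      · simp [Set.indicator_of_mem hx, hχ.one x hx]
      · simp only [Set.indicator_of_notMem hx]
        exact mul_nonneg (pow_nonneg (hχ.nonneg x) _) (hE0 x)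
  have hQ0 := hQ u hu
  have hI0 : 0 ≤ ∫ x in Metric.closedBall x0 r', Hh A (u x) ^ q := integral_nonneg fun x =>
    Real.rpow_nonneg (by linarith [Hh_ge (A := A) (hu0 x)]) _
  rw [div_mul_eq_mul_div, le_div_iff₀ (by positivity)]
  have hcp : 0 < c * ((p - 1) / 2) := by positivity
  have h5 := mul_le_mul_of_nonneg_right h1 hcp.le
  have h6 : (∫ x, χ x ^ m * E x) * (c * ((p - 1) / 2)) = c * ((p - 1) / 2 * ∫ x, χ x ^ m * E x) := by ring
  rw [h6] at h5
  have h7 : 0 ≤ N * Qp p Ω V u := mul_nonneg hN0 hQ0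
  linarith




lemma split_pow (hp : 0 < p) {a t : ℝ} (ha : 0 ≤ a) (ht : 0 ≤ t) :
    a ^ p ≤ 2 ^ p * ((max (a - t) 0) ^ p + t ^ p) := by
  set b := max (a - t) 0 with hb
  have hb0 : 0 ≤ b := le_max_right _ _
  have h1 : a ≤ b + t := by have := le_max_left (a - t) 0; linarith
  have h2 : a ≤ 2 * max b t := by
    have := le_max_left b t; have := le_max_right b t; linarith
  calc a ^ p ≤ (2 * max b t) ^ p := Real.rpow_le_rpow ha h2 hp.le
    _ = 2 ^ p * (max b t) ^ p := Real.mul_rpow (by norm_num) (le_max_of_le_left hb0)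
    _ ≤ _ := by
      gcongr
      rcases max_choice b t with h | h <;> rw [h]
      · have : 0 ≤ t ^ p := by positivity
        linarith
      · have : 0 ≤ b ^ p := by positivity
        linarith

lemma vb_nonneg (l : ℝ) : 0 ≤ vb d l := by unfold vb; positivity

lemma vol_real_ball (x : Ed d) (l : ℝ) : volume.real (Metric.closedBall x l) = vb d l := by
  rw [measureReal_def, vb_eq, ENNReal.toReal_ofReal (vb_nonneg l)]

lemma mom (hp : 1 < p) (hV : LocBddOn Ω V) (hQ : NonnegOn p Ω V) {x0 : Ed d} {R0 A : ℝ} (hR0 : 0 < R0)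
    (hb : Metric.closedBall x0 R0 ⊆ Ω) (hA : 1 ≤ A) {K : ℕ} (hAK : 2 * (K * p) ≤ (p - 1) * A) :
    ∀ k : ℕ, k ≤ K → ∃ r, 0 < r ∧ r ≤ R0 ∧ ∀ θ : ℝ, 0 < θ → ∃ C : ℝ, ∀ u, IsTestOn Ω u → (∀ x, 0 ≤ u x) →
      Qp p Ω V u ≤ 1 → ENNReal.ofReal θ ≤ volume {y | y ∈ Metric.closedBall x0 r ∧ u y ≤ 1} →
      ∫ x in Metric.closedBall x0 r, Hh A (u x) ^ (k * p) ≤ C := by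
  have hp0 : 0 < p := by linarith
  intro k
  induction k with
  | zero =>
    intro _
    refine ⟨R0, hR0, le_rfl, fun θ _ => ⟨vb d R0, fun u _ _ _ _ => ?_⟩⟩
    simp [vol_real_ball]
  | succ k ih =>
    intro hk
    obtain ⟨rk, hrk, hrkR, ih⟩ := ih (by omega)
    have hkK : (k:ℝ) ≤ K := by exact_mod_cast (by omega : k ≤ K)
    have hbk : Metric.closedBall x0 rk ⊆ Ω := (Metric.closedBall_subset_closedBall hrkR).trans hb
    set r := rk / 9 with hr
    have hr0 : 0 < r := by positivity
    obtain ⟨C1, hC1, hmos⟩ := moser hp hV hQ (A := A) (q := k * p) hA (by positivity)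
      (by have : (k:ℝ) * p ≤ K * p := by gcongr
          linarith) x0 (r := r + 2 * r) (r' := rk) (by positivity) (by rw [hr]; linarith) hbk
    refine ⟨r, hr0, by rw [hr]; linarith, fun θ hθ => ?_⟩
    obtain ⟨C2, hC2⟩ := ih θ hθ
    set t := (A + Real.log 2) ^ (k + 1) with ht
    have hlog2 : 0 < Real.log 2 := Real.log_pos (by norm_num)
    have ht0 : 0 ≤ t := by positivity
    refine ⟨2 ^ p * ((vb d (2 * r) * (2 * r) ^ p * ((k + 1 : ℝ) ^ p * (C1 * (1 + C2)))) / θ + t ^ p * vb d r), fun u hu hu0 hQu hm => ?_⟩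
    have hHpos : ∀ x, 0 < Hh A (u x) := fun x => by linarith [Hh_ge (A := A) (hu0 x)]
    have hsub : Metric.closedBall x0 r ⊆ Metric.closedBall x0 rk :=
      Metric.closedBall_subset_closedBall (by rw [hr]; linarith)
    have h1 := hC2 u hu hu0 hQu (hm.trans (measure_mono fun y hy => ⟨hsub hy.1, hy.2⟩))
    have h2 := hmos u hu hu0
    have h2' : ∫ x in Metric.closedBall x0 (r + 2 * r), Hh A (u x) ^ (k * p) * (‖fderiv ℝ u x‖ / (1 + u x)) ^ p ≤ C1 * (1 + C2) := by
      refine h2.trans ?_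
      gcongr
    have s1 := (Hh_smooth (p := p) (q := 0) hA hu hu0).1
    set h : Ed d → ℝ := fun x => Hh A (u x) ^ (k + 1) with hh
    have hhs : ContDiff ℝ 1 h := (s1.pow (k + 1)).of_le (by exact_mod_cast le_top)
    have h3 := poin hp.le hhs x0 (r := r) (l := 2 * r) (t := t) (θ := θ) (by positivity) hθ.le (by
      intro x hx
      refine hm.trans (measure_mono ?_)
      rintro y ⟨hy1, hy2⟩
      refine ⟨?_, ?_⟩
      · rw [Metric.mem_closedBall] at *
        calc dist y x ≤ dist y x0 + dist x0 x := dist_triangle _ _ _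
          _ ≤ r + r := add_le_add hy1 (by rw [dist_comm]; exact hx)
          _ = 2 * r := by ring
      · rw [hh, ht]
        refine pow_le_pow_left₀ (hHpos y).le ?_ _
        unfold Hh
        have : Real.log (1 + u y) ≤ Real.log 2 := Real.log_le_log (by linarith [hu0 y]) (by linarith)
        linarith)
    have h4 : ∫ x in Metric.closedBall x0 (r + 2 * r), ‖fderiv ℝ h x‖ ^ p =
        (k + 1 : ℝ) ^ p * ∫ x in Metric.closedBall x0 (r + 2 * r), Hh A (u x) ^ (k * p) * (‖fderiv ℝ u x‖ / (1 + u x)) ^ p := by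
      rw [← integral_const_mul]
      congr 1
      ext x
      have hu1 : 0 < 1 + u x := by linarith [hu0 x]
      have e1 : HasFDerivAt (fun x => Hh A (u x)) ((1 + u x)⁻¹ • fderiv ℝ u x) x := by
        have := (((test_diff hu x).hasFDerivAt.const_add 1).log hu1.ne').const_add A
        exact this
      have e2 := e1.pow (k + 1)
      rw [show h = fun x => Hh A (u x) ^ (k + 1) from rfl, e2.fderiv, smul_smul, norm_smul]
      simp only [Nat.add_sub_cancel, nsmul_eq_mul]
      have hHx := hHpos x
      rw [Real.norm_of_nonneg (by positivity)]
      have : ((k + 1 : ℕ) : ℝ) * Hh A (u x) ^ k * (1 + u x)⁻¹ * ‖fderiv ℝ u x‖ =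
        (k + 1 : ℝ) * (Hh A (u x) ^ k * (‖fderiv ℝ u x‖ / (1 + u x))) := by push_cast; field_simp
      rw [this, Real.mul_rpow (by positivity) (by positivity), Real.mul_rpow (by positivity) (by positivity),
        ← Real.rpow_natCast_mul hHx.le]
    rw [h4] at h3
    have h5 : ∫ x in Metric.closedBall x0 r, (max (h x - t) 0) ^ p ≤
        (vb d (2 * r) * (2 * r) ^ p * ((k + 1 : ℝ) ^ p * (C1 * (1 + C2)))) / θ := by
      rw [le_div_iff₀ hθ, mul_comm]
      refine h3.trans ?_
      have := vb_nonneg (d := d) (2 * r)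
      gcongr
    have c1 : Continuous fun x => (max (h x - t) 0) ^ p :=
      Continuous.rpow_const ((hhs.continuous.sub continuous_const).max continuous_const) (fun _ => Or.inr hp0.le)
    have c2 : Continuous fun x => Hh A (u x) ^ ((k + 1 : ℕ) * p) := (Hh_smooth (p := p) (q := (k + 1 : ℕ) * p) hA hu hu0).2.1.continuous
    calc ∫ x in Metric.closedBall x0 r, Hh A (u x) ^ ((k + 1 : ℕ) * p)
        ≤ ∫ x in Metric.closedBall x0 r, 2 ^ p * ((max (h x - t) 0) ^ p + t ^ p) := by
          apply setIntegral_mono (cont_intOn c2 _ _) (cont_intOn (continuous_const.mul (c1.add continuous_const)) _ _)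
          intro x
          have : Hh A (u x) ^ ((k + 1 : ℕ) * p) = (h x) ^ p := by
            rw [hh, Real.rpow_natCast_mul (hHpos x).le]
          simp only [this]
          exact split_pow hp0 (pow_nonneg (hHpos x).le _) ht0
      _ = 2 ^ p * (∫ x in Metric.closedBall x0 r, (max (h x - t) 0) ^ p) + 2 ^ p * (t ^ p * vb d r) := by
          rw [integral_const_mul, integral_add (cont_intOn c1 _ _) (cont_intOn continuous_const _ _),
            setIntegral_const, vol_real_ball, smul_eq_mul]; ring
      _ ≤ _ := by
          rw [mul_add]
          gcongr

/-- tail estimate -/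
lemma tail (hp : 1 < p) (hV : LocBddOn Ω V) (hQ : NonnegOn p Ω V) {x0 : Ed d} {R0 : ℝ} (hR0 : 0 < R0)
    (hb : Metric.closedBall x0 R0 ⊆ Ω) : ∃ r, 0 < r ∧ r ≤ R0 ∧ ∀ θ : ℝ, 0 < θ → ∃ C : ℝ, 0 < C ∧ ∀ u, IsTestOn Ω u → (∀ x, 0 ≤ u x) →
      Qp p Ω V u ≤ 1 → ENNReal.ofReal θ ≤ volume {y | y ∈ Metric.closedBall x0 r ∧ u y ≤ 1} →
      ∀ s : ℝ, 0 < s → volume {y | y ∈ Metric.closedBall x0 r ∧ Real.exp s < u y} ≤ ENNReal.ofReal (C / s ^ (2 * d + 1)) := by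
  have hp1 : 0 < p - 1 := by linarith
  set K := 2 * d + 1 with hK
  set A := max 1 (2 * (K * p) / (p - 1)) with hA
  obtain ⟨r, hr, hrR, h⟩ := mom hp hV hQ hR0 hb (A := A) (le_max_left _ _) (K := K) (by
    have := le_max_right 1 (2 * (K * p) / (p - 1))
    rw [div_le_iff₀ hp1] at this
    linarith) K le_rfl
  refine ⟨r, hr, hrR, fun θ hθ => ?_⟩
  obtain ⟨C, hC⟩ := h θ hθ
  refine ⟨max C 1, by positivity, fun u hu hu0 hQu hm s hs => ?_⟩
  have h1 := (hC u hu hu0 hQu hm).trans (le_max_left C 1)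
  have hA1 : 1 ≤ A := le_max_left _ _
  have c2 : Continuous fun x => Hh A (u x) ^ ((K : ℝ) * p) := (Hh_smooth (p := p) (q := K * p) hA1 hu hu0).2.1.continuous
  have h2 := mul_meas_ge_le_integral_of_nonneg (μ := volume.restrict (Metric.closedBall x0 r))
    (f := fun x => Hh A (u x) ^ ((K : ℝ) * p)) (Eventually.of_forall fun x =>
    Real.rpow_nonneg (by linarith [Hh_ge (A := A) (hu0 x)]) _) (cont_intOn c2 x0 r) (s ^ K)
  have h3 : volume.real {y | y ∈ Metric.closedBall x0 r ∧ Real.exp s < u y} ≤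
      (volume.restrict (Metric.closedBall x0 r)).real {x | s ^ K ≤ Hh A (u x) ^ ((K : ℝ) * p)} := by
    rw [measureReal_restrict_apply (measurableSet_le measurable_const c2.measurable)]
    apply measureReal_mono
    · rintro y ⟨hy1, hy2⟩
      refine ⟨?_, hy1⟩
      have h4 : s ≤ Real.log (1 + u y) := by
        rw [Real.le_log_iff_exp_le (by linarith [hu0 y])]; linarith
      have h5 : 1 + s ≤ Hh A (u y) := by unfold Hh; linarith
      show s ^ K ≤ _
      calc s ^ K ≤ (1 + s) ^ K := by gcongr; linarith
        _ = (1 + s) ^ (K : ℝ) := (Real.rpow_natCast _ _).symm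
        _ ≤ (1 + s) ^ ((K : ℝ) * p) := Real.rpow_le_rpow_of_exponent_le (by linarith) (by
            have : (0:ℝ) ≤ K := by positivity
            nlinarith)
        _ ≤ _ := Real.rpow_le_rpow (by linarith) h5 (by positivity)
    · exact ((measure_mono Set.inter_subset_right).trans_lt measure_closedBall_lt_top).ne
  rw [← ofReal_measureReal (h := ((measure_mono (fun y hy => hy.1)).trans_lt (measure_closedBall_lt_top (x := x0) (r := r))).ne)]
  apply ENNReal.ofReal_le_ofReal
  rw [le_div_iff₀ (by positivity), mul_comm]
  refine le_trans ?_ (h2.trans h1)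
  gcongr




lemma rec_bound {a : ℕ → ℝ} {b c B : ℝ} (hb : 0 ≤ b) (hc : 0 ≤ c) (hB : ∀ j, a j ≤ B)
    (h : ∀ j, a j ≤ 1 / 2 * a (j + 1) + b + c * (3 / 2) ^ j) : a 0 ≤ 2 * b + 4 * c := by
  have key : ∀ n j, a j ≤ 2 * b + 4 * c * (3 / 2) ^ j + B * (1 / 2) ^ n := by
    intro n
    induction n with
    | zero =>
      intro j
      have := hB j
      have : 0 ≤ 2 * b + 4 * c * (3 / 2) ^ j := by positivity
      simp; linarith
    | succ n ih =>
      intro j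
      have h1 := ih (j + 1)
      have h2 := h j
      rw [pow_succ] at h1 ⊢
      linarith
  have h1 : Tendsto (fun n : ℕ => 2 * b + 4 * c + B * (1 / 2 : ℝ) ^ n) atTop (𝓝 (2 * b + 4 * c + B * 0)) :=
    ((tendsto_pow_atTop_nhds_zero_of_lt_one (by norm_num) (by norm_num)).const_mul B).const_add _
  have := ge_of_tendsto' h1 (fun n => by simpa using key n 0)
  simpa using this

lemma vb_scale {l : ℝ} (hl : 0 ≤ l) : vb d l = l ^ d * vb d 1 := by
  have h := Measure.addHaar_real_closedBall (volume : Measure (Ed d)) 0 hl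
  have h1 := Measure.addHaar_real_closedBall (volume : Measure (Ed d)) 0 zero_le_one
  simp only [finrank_euclideanSpace, Fintype.card_fin] at h h1
  unfold vb
  rw [h, h1]; simp

lemma vb_pos {l : ℝ} (hl : 0 < l) : 0 < vb d l := by
  unfold vb
  rw [measureReal_def]
  exact ENNReal.toReal_pos (Metric.measure_closedBall_pos _ _ hl).ne' measure_closedBall_lt_top.ne

lemma iter (hp : 1 < p) (hV : LocBddOn Ω V) (hQ : NonnegOn p Ω V) {x0 : Ed d} {R : ℝ} (hR : 0 < R)
    (hb : Metric.closedBall x0 R ⊆ Ω) {C : ℝ} (hC : 0 < C) : ∃ C' : ℝ, ∀ u, IsTestOn Ω u → (∀ x, 0 ≤ u x) →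
      Qp p Ω V u ≤ 1 →
      (∀ s : ℝ, 0 < s → volume {y | y ∈ Metric.closedBall x0 R ∧ Real.exp s < u y} ≤ ENNReal.ofReal (C / s ^ (2 * d + 1))) →
      ∫ x in Metric.closedBall x0 (R / 2), |u x| ^ p ≤ C' := by
  have hp0 : 0 < p := by linarith
  obtain ⟨K, hK, hcacc⟩ := cacc2 (d := d) hp hV hQ
  obtain ⟨M0, hM0⟩ := hV.2 _ (isCompact_closedBall x0 R) hb
  set M := max M0 0 with hMd
  have hM : ∀ᵐ x, x ∈ Metric.closedBall x0 R → |V x| ≤ M := by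
    filter_upwards [hM0] with x hx h
    exact (hx h).trans (le_max_left _ _)
  have hMn : 0 ≤ M := le_max_right _ _
  set N := 2 ^ p * (2 * ((2 * K) ^ p + M * R ^ p)) with hN
  have hN0 : 0 < N := by positivity
  obtain ⟨κ, hκ0, hκ1, hκ2⟩ : ∃ κ : ℝ, 0 < κ ∧ κ ≤ 1 / 2 ∧ κ ^ p * N ≤ 1 / 2 := by
    refine ⟨min (1 / 2) ((1 / (2 * N)) ^ (1 / p)), by positivity, min_le_left _ _, ?_⟩
    calc _ ≤ ((1 / (2 * N)) ^ (1 / p)) ^ p * N := by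
          gcongr
          exact min_le_right _ _
      _ = 1 / 2 := by
          rw [← Real.rpow_mul (by positivity), one_div_mul_cancel hp0.ne', Real.rpow_one]; field_simp
  set r : ℕ → ℝ := fun j => R * (1 - 1 / (2 * (j + 1))) with hr
  set g : ℕ → ℝ := fun j => R / (2 * (j + 1) * (j + 2)) with hg
  have hg0 : ∀ j, 0 < g j := fun j => by simp only [hg]; positivity
  have hrg : ∀ j, r (j + 1) = r j + g j := fun j => by
    simp only [hr, hg]; push_cast; field_simp; ring
  have hr0 : ∀ j, 0 < r j := fun j => by
    simp only [hr]
    apply mul_pos hR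
    rw [sub_pos, div_lt_one (by positivity)]
    have : (0:ℝ) ≤ j := by positivity
    linarith
  have hrR : ∀ j, r j ≤ R := fun j => by
    simp only [hr]
    have : 0 ≤ 1 / (2 * ((j:ℝ) + 1)) := by positivity
    nlinarith
  have hgR : ∀ j, g j ≤ R := fun j => by
    simp only [hg]
    rw [div_le_iff₀ (by positivity)]
    have : (0:ℝ) ≤ j := by positivity
    have : 1 ≤ 2 * ((j:ℝ) + 1) * (j + 2) := by nlinarith
    nlinarith
  set lg := Real.log (3 / 2) with hlg
  have hlg0 : 0 < lg := Real.log_pos (by norm_num)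
  have hω := vb_pos (d := d) (l := 1) one_pos
  set D := 1 / 2 * vb d 1 * (κ * R / 4) ^ d with hD
  have hD0 : 0 < D := by positivity
  obtain ⟨L, hL⟩ := exists_nat_ge (C * (p / lg) ^ (2 * d + 1) / D + 1)
  have hL1 : (1:ℝ) ≤ L := by
    have : 0 ≤ C * (p / lg) ^ (2 * d + 1) / D := by positivity
    linarith
  have hL2 : C * (p / lg) ^ (2 * d + 1) ≤ D * L := by
    have : C * (p / lg) ^ (2 * d + 1) / D ≤ L := by linarith
    rw [div_le_iff₀ hD0] at this
    linarith
  set s : ℕ → ℝ := fun j => (j + L) * lg / p with hs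
  have hs0 : ∀ j, 0 < s j := fun j => by simp only [hs]; positivity
  have hmeas : ∀ j, C / s j ^ (2 * d + 1) ≤ 1 / 2 * vb d (κ * g j) := by
    intro j
    rw [vb_scale (by have := hg0 j; positivity)]
    have e1 : s j ^ (2 * d + 1) = (j + L) ^ (2 * d + 1) / (p / lg) ^ (2 * d + 1) := by
      rw [← div_pow]; congr 1; simp only [hs]; field_simp
    have e2 : κ * R / 4 / ((j + 1) ^ 2 : ℝ) ≤ κ * g j := by
      simp only [hg]
      rw [mul_div_assoc, mul_div_assoc, div_div]
      apply mul_le_mul_of_nonneg_left _ hκ0.le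
      apply div_le_div_of_nonneg_left hR.le (by positivity)
      have : (0:ℝ) ≤ j := by positivity
      nlinarith
    have e3 : (L : ℝ) * ((j + 1 : ℝ)) ^ (2 * d) ≤ (j + L) ^ (2 * d + 1) := by
      rw [pow_succ, mul_comm]
      have : (0:ℝ) ≤ j := by positivity
      gcongr
      linarith
    rw [e1, div_div_eq_mul_div]
    calc C * (p / lg) ^ (2 * d + 1) / (j + L) ^ (2 * d + 1) ≤ D * L / (L * (j + 1 : ℝ) ^ (2 * d)) := by
          gcongr
      _ = D / (j + 1 : ℝ) ^ (2 * d) := by field_simp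
      _ = 1 / 2 * ((κ * R / 4 / ((j + 1) ^ 2 : ℝ)) ^ d * vb d 1) := by
          rw [hD, div_pow (κ * R / 4) _ d, ← pow_mul]; ring
      _ ≤ _ := by gcongr
  refine ⟨2 * (2 ^ p * (2 * R ^ p)) + 4 * (2 ^ p * vb d R * (3 / 2) ^ L), fun u hu hu0 hQu htail => ?_⟩
  set a : ℕ → ℝ := fun j => ∫ x in Metric.closedBall x0 (r j), |u x| ^ p with ha
  have cu : Continuous fun x => |u x| ^ p := (abs_rpow_supp hp0 hu).1
  have ha0 : ∀ j, 0 ≤ a j := fun j => integral_nonneg fun x => by positivity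
  have hfin := rec_bound (a := a) (b := 2 ^ p * (2 * R ^ p)) (c := 2 ^ p * vb d R * (3 / 2) ^ L)
    (B := ∫ x in Metric.closedBall x0 R, |u x| ^ p) (by positivity)
    (by have := vb_nonneg (d := d) R; positivity)
    (fun j => setIntegral_mono_set (cont_intOn cu _ _) (Eventually.of_forall fun x => by positivity)
      (Metric.closedBall_subset_closedBall (hrR j)).eventuallyLE) ?_
  · have : r 0 = R / 2 := by simp only [hr]; push_cast; ring
    simpa only [ha, this] using hfin
  intro j
  set l := κ * g j with hl
  set t := Real.exp (s j) with ht
  have hgj := hg0 j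
  have hl0 : 0 < l := by positivity
  have hlg2 : l ≤ g j / 2 := by rw [hl]; nlinarith
  have hrj := hrg j
  have hrR1 := hrR (j + 1)
  have hvl := vb_pos (d := d) hl0
  have h1 := poin hp.le (h := u) (hu.1.of_le (by exact_mod_cast le_top)) x0 (r := r j) (l := l) (t := t)
    (θ := 1 / 2 * vb d l) hl0.le (by positivity) (by
      intro x hx
      have hsub : Metric.closedBall x l ⊆ Metric.closedBall x0 R := by
        apply Metric.closedBall_subset_closedBall'
        rw [Metric.mem_closedBall] at hx
        linarith
      have m1 : volume (Metric.closedBall x l) ≤ volume {y | y ∈ Metric.closedBall x l ∧ u y ≤ t} +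
          volume {y | y ∈ Metric.closedBall x0 R ∧ t < u y} := by
        refine (measure_mono ?_).trans (measure_union_le _ _)
        intro y hy
        rcases le_or_gt (u y) t with h | h
        · exact Or.inl ⟨hy, h⟩
        · exact Or.inr ⟨hsub hy, h⟩
      have m2 := (htail (s j) (hs0 j)).trans (ENNReal.ofReal_le_ofReal (hmeas j))
      rw [vb_eq] at m1
      have m3 : ENNReal.ofReal (vb d l) = ENNReal.ofReal (1 / 2 * vb d l) + ENNReal.ofReal (1 / 2 * vb d l) := by
        rw [← ENNReal.ofReal_add (by positivity) (by positivity)]; congr 1; ring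
      rw [m3] at m1
      exact (ENNReal.add_le_add_iff_right ENNReal.ofReal_ne_top).1 (m1.trans (add_le_add le_rfl m2)))
  have h2 : ∫ x in Metric.closedBall x0 (r j), (max (u x - t) 0) ^ p ≤
      2 * l ^ p * ∫ x in Metric.closedBall x0 (r j + l), ‖fderiv ℝ u x‖ ^ p := by
    have : vb d l * l ^ p * ∫ x in Metric.closedBall x0 (r j + l), ‖fderiv ℝ u x‖ ^ p =
      (1 / 2 * vb d l) * (2 * l ^ p * ∫ x in Metric.closedBall x0 (r j + l), ‖fderiv ℝ u x‖ ^ p) := by ring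
    rw [this] at h1
    exact le_of_mul_le_mul_left h1 (by positivity)
  have cdu : Continuous fun x => ‖fderiv ℝ u x‖ ^ p := (test_fcont hu).norm.rpow_const (fun _ => Or.inr hp0.le)
  have h3 : ∫ x in Metric.closedBall x0 (r j + l), ‖fderiv ℝ u x‖ ^ p ≤
      1 + ((2 * K / g j) ^ p + M) * a (j + 1) := by
    have := hcacc x0 (r j + g j / 2) (r (j + 1)) M (by have := hr0 j; positivity) (by linarith) (by
      filter_upwards [hM] with x hx h
      exact hx (Metric.closedBall_subset_closedBall hrR1 h)) u hu
    have e : K / (r (j + 1) - (r j + g j / 2)) = 2 * K / g j := by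
      rw [hrj, show r j + g j - (r j + g j / 2) = g j / 2 by ring]; field_simp
    rw [e] at this
    have h4 : ∫ x in Metric.closedBall x0 (r j + l), ‖fderiv ℝ u x‖ ^ p ≤
        ∫ x in Metric.closedBall x0 (r j + g j / 2), ‖fderiv ℝ u x‖ ^ p :=
      setIntegral_mono_set (cont_intOn cdu _ _) (Eventually.of_forall fun x => by positivity)
        (Metric.closedBall_subset_closedBall (by linarith)).eventuallyLE
    simp only [ha]
    linarith
  have h5 : 2 ^ p * (∫ x in Metric.closedBall x0 (r j), (max (u x - t) 0) ^ p) ≤ 2 ^ p * (2 * R ^ p) + 1 / 2 * a (j + 1) := by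
    have e1 : l ^ p = κ ^ p * g j ^ p := Real.mul_rpow hκ0.le hgj.le
    have e2 : g j ^ p * (2 * K / g j) ^ p = (2 * K) ^ p := by
      rw [← Real.mul_rpow hgj.le (by positivity)]; congr 1; field_simp
    have e3 : g j ^ p ≤ R ^ p := Real.rpow_le_rpow hgj.le (hgR j) hp0.le
    have e4 : κ ^ p ≤ 1 := Real.rpow_le_one hκ0.le (by linarith) hp0.le
    have haj := ha0 (j + 1)
    calc 2 ^ p * (∫ x in Metric.closedBall x0 (r j), (max (u x - t) 0) ^ p)
        ≤ 2 ^ p * (2 * l ^ p * (1 + ((2 * K / g j) ^ p + M) * a (j + 1))) := by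
          refine mul_le_mul_of_nonneg_left (h2.trans ?_) (by positivity)
          gcongr
      _ = 2 ^ p * (2 * (κ ^ p * g j ^ p)) + κ ^ p * (2 ^ p * (2 * (g j ^ p * (2 * K / g j) ^ p + M * g j ^ p))) * a (j + 1) := by
          rw [e1]; ring
      _ ≤ 2 ^ p * (2 * (1 * R ^ p)) + κ ^ p * (2 ^ p * (2 * ((2 * K) ^ p + M * R ^ p))) * a (j + 1) := by
          rw [e2]; gcongr
      _ ≤ _ := by
          rw [one_mul]
          gcongr
  have c1 : Continuous fun x => (max (u x - t) 0) ^ p :=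
    Continuous.rpow_const (((test_cont hu).sub continuous_const).max continuous_const) (fun _ => Or.inr hp0.le)
  have htp : t ^ p = (3 / 2) ^ L * (3 / 2) ^ j := by
    rw [ht, ← Real.exp_mul, ← pow_add]
    have : s j * p = ((L + j : ℕ) : ℝ) * lg := by simp only [hs]; push_cast; field_simp; ring
    rw [this, Real.exp_nat_mul, Real.exp_log (by norm_num)]
  calc a j ≤ ∫ x in Metric.closedBall x0 (r j), 2 ^ p * ((max (u x - t) 0) ^ p + t ^ p) := by
        apply setIntegral_mono (cont_intOn cu _ _) (cont_intOn (continuous_const.mul (c1.add continuous_const)) _ _)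
        intro x
        simp only [abs_of_nonneg (hu0 x)]
        exact split_pow hp0 (hu0 x) (Real.exp_pos _).le
    _ = 2 ^ p * (∫ x in Metric.closedBall x0 (r j), (max (u x - t) 0) ^ p) + 2 ^ p * (t ^ p * vb d (r j)) := by
        rw [integral_const_mul, integral_add (cont_intOn c1 _ _) (cont_intOn continuous_const _ _),
          setIntegral_const, vol_real_ball, smul_eq_mul]; ring
    _ ≤ (2 ^ p * (2 * R ^ p) + 1 / 2 * a (j + 1)) + 2 ^ p * (t ^ p * vb d R) := by
        gcongr
        unfold vb
        exact measureReal_mono (Metric.closedBall_subset_closedBall (hrR j)) measure_closedBall_lt_top.ne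
    _ = _ := by rw [htp]; ring

lemma LL (hp : 1 < p) (hV : LocBddOn Ω V) (hQ : NonnegOn p Ω V) {x0 : Ed d} {R0 : ℝ} (hR0 : 0 < R0)
    (hb : Metric.closedBall x0 R0 ⊆ Ω) : ∃ ρ, 0 < ρ ∧ ρ ≤ R0 ∧ ∀ θ : ℝ, 0 < θ → ∃ C : ℝ, 0 < C ∧
      ∀ u, IsTestOn Ω u → (∀ x, 0 ≤ u x) → ∀ δ : ℝ, 0 < δ →
      Qp p Ω V u ≤ δ ^ p → ENNReal.ofReal θ ≤ volume {y | y ∈ Metric.closedBall x0 ρ ∧ u y ≤ δ} →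
      ∫ x in Metric.closedBall x0 ρ, |u x| ^ p ≤ C * δ ^ p := by
  have hp0 : 0 < p := by linarith
  obtain ⟨r, hr, hrR, h⟩ := tail hp hV hQ hR0 hb
  refine ⟨r / 2, by positivity, by linarith, fun θ hθ => ?_⟩
  obtain ⟨C1, hC1, h1⟩ := h θ hθ
  obtain ⟨C2, h2⟩ := iter hp hV hQ hr ((Metric.closedBall_subset_closedBall hrR).trans hb) hC1
  refine ⟨max C2 1, by positivity, fun u hu hu0 δ hδ hQu hm => ?_⟩
  set v : Ed d → ℝ := fun x => δ⁻¹ * u x with hv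
  have hvt : IsTestOn Ω v := test_smul _ hu
  have hv0 : ∀ x, 0 ≤ v x := fun x => mul_nonneg (by positivity) (hu0 x)
  have hQv : Qp p Ω V v ≤ 1 := by
    rw [hv, Qp_smul hp0 (by positivity) hu, Real.inv_rpow hδ.le, inv_mul_le_iff₀ (by positivity)]
    simpa using hQu
  have hmv : ENNReal.ofReal θ ≤ volume {y | y ∈ Metric.closedBall x0 r ∧ v y ≤ 1} := by
    refine hm.trans (measure_mono ?_)
    rintro y ⟨hy1, hy2⟩
    refine ⟨Metric.closedBall_subset_closedBall (by linarith) hy1, ?_⟩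
    show δ⁻¹ * u y ≤ 1
    rw [inv_mul_le_iff₀ hδ]; simpa using hy2
  have h3 := h2 v hvt hv0 hQv (h1 v hvt hv0 hQv hmv)
  have h4 : ∫ x in Metric.closedBall x0 (r / 2), |v x| ^ p = (δ ^ p)⁻¹ * ∫ x in Metric.closedBall x0 (r / 2), |u x| ^ p := by
    rw [← integral_const_mul]
    congr 1; ext x
    rw [hv, abs_mul, Real.mul_rpow (abs_nonneg _) (abs_nonneg _), abs_of_pos (inv_pos.2 hδ), Real.inv_rpow hδ.le]
  rw [h4, inv_mul_le_iff₀ (by positivity)] at h3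
  refine h3.trans ?_
  rw [mul_comm]
  gcongr
  exact le_max_left _ _




lemma cheb (hp : 0 < p) (hu : IsTestOn Ω u) (hu0 : ∀ x, 0 ≤ u x) {y : Ed d} {σ δ : ℝ} (hδ : 0 < δ)
    (h : ∫ x in Metric.closedBall y σ, |u x| ^ p ≤ 1 / 2 * vb d σ * δ ^ p) :
    ENNReal.ofReal (1 / 2 * vb d σ) ≤ volume {z | z ∈ Metric.closedBall y σ ∧ u z ≤ δ} := by
  have cu : Continuous fun x => |u x| ^ p := (abs_rpow_supp hp hu).1
  have hvb := vb_nonneg (d := d) σ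
  have h2 := mul_meas_ge_le_integral_of_nonneg (μ := volume.restrict (Metric.closedBall y σ))
    (f := fun x => |u x| ^ p) (Eventually.of_forall fun x => by positivity) (cont_intOn cu y σ) (δ ^ p)
  have hfin : ∀ S : Set (Ed d), volume (S ∩ Metric.closedBall y σ) ≠ ⊤ := fun S =>
    ((measure_mono Set.inter_subset_right).trans_lt measure_closedBall_lt_top).ne
  rw [measureReal_restrict_apply (measurableSet_le measurable_const cu.measurable)] at h2
  have h3 : volume.real ({x | δ ^ p ≤ |u x| ^ p} ∩ Metric.closedBall y σ) ≤ 1 / 2 * vb d σ := by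
    have hδp : 0 < δ ^ p := by positivity
    have := h2.trans h
    rw [mul_comm] at this
    exact le_of_mul_le_mul_right this hδp
  have m1 : volume (Metric.closedBall y σ) ≤ volume {z | z ∈ Metric.closedBall y σ ∧ u z ≤ δ} +
      volume ({x | δ ^ p ≤ |u x| ^ p} ∩ Metric.closedBall y σ) := by
    refine (measure_mono ?_).trans (measure_union_le _ _)
    intro z hz
    rcases le_or_gt (u z) δ with h | h
    · exact Or.inl ⟨hz, h⟩
    · refine Or.inr ⟨?_, hz⟩
      show δ ^ p ≤ |u z| ^ p
      rw [abs_of_nonneg (hu0 z)]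
      exact Real.rpow_le_rpow hδ.le h.le hp.le
  have m2 : volume ({x | δ ^ p ≤ |u x| ^ p} ∩ Metric.closedBall y σ) ≤ ENNReal.ofReal (1 / 2 * vb d σ) := by
    rw [← ofReal_measureReal (h := hfin _)]
    exact ENNReal.ofReal_le_ofReal h3
  rw [vb_eq] at m1
  have m3 : ENNReal.ofReal (vb d σ) = ENNReal.ofReal (1 / 2 * vb d σ) + ENNReal.ofReal (1 / 2 * vb d σ) := by
    rw [← ENNReal.ofReal_add (by positivity) (by positivity)]; congr 1; ring
  rw [m3] at m1
  exact (ENNReal.add_le_add_iff_right ENNReal.ofReal_ne_top).1 (m1.trans (add_le_add le_rfl m2))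

lemma ball_mono (hp : 0 < p) (hu : IsTestOn Ω u) {S T : Set (Ed d)} (h : S ⊆ T) :
    ∫ x in S, |u x| ^ p ≤ ∫ x in T, |u x| ^ p :=
  setIntegral_mono_set (int_pow hp hu).integrableOn (Eventually.of_forall fun x => by positivity)
    h.eventuallyLE

lemma lemmaA (hp : 1 < p) (hV : LocBddOn Ω V) (hQ : NonnegOn p Ω V) (hopen : IsOpen Ω)
    (hconn : IsPreconnected Ω) {x1 : Ed d} (hx1 : x1 ∈ Ω) {ρ0 : ℝ} (hρ0 : 0 < ρ0) :
    ∀ x ∈ Ω, ∃ ρ, 0 < ρ ∧ ∃ C, 0 < C ∧ ∀ u, IsTestOn Ω u → (∀ x, 0 ≤ u x) →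
      ∫ y in Metric.closedBall x ρ, |u y| ^ p ≤ C * (Qp p Ω V u + ∫ y in Metric.closedBall x1 ρ0, |u y| ^ p) := by
  have hp0 : 0 < p := by linarith
  set S : Set (Ed d) := {x | ∃ ρ, 0 < ρ ∧ ∃ C, 0 < C ∧ ∀ u, IsTestOn Ω u → (∀ x, 0 ≤ u x) →
      ∫ y in Metric.closedBall x ρ, |u y| ^ p ≤ C * (Qp p Ω V u + ∫ y in Metric.closedBall x1 ρ0, |u y| ^ p)} with hS
  refine hconn.subset_of_closure_inter_subset (u := S) ?_ ⟨x1, hx1, ?_⟩ ?_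
  · rw [Metric.isOpen_iff]
    rintro x ⟨ρ, hρ, C, hC, h⟩
    refine ⟨ρ / 2, by positivity, fun y hy => ⟨ρ / 2, by positivity, C, hC, fun u hu hu0 => ?_⟩⟩
    refine (ball_mono hp0 hu ?_).trans (h u hu hu0)
    apply Metric.closedBall_subset_closedBall'
    rw [Metric.mem_ball] at hy
    linarith
  · refine ⟨ρ0, hρ0, 1, one_pos, fun u hu hu0 => ?_⟩
    have := hQ u hu
    linarith
  · rintro x ⟨hxc, hxΩ⟩
    obtain ⟨R0, hR0, hb⟩ := Metric.nhds_basis_closedBall.mem_iff.1 (hopen.mem_nhds hxΩ)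
    obtain ⟨ρ, hρ, -, hLL⟩ := LL hp hV hQ hR0 hb
    obtain ⟨y, hyS, hxy⟩ := Metric.mem_closure_iff.1 hxc (ρ / 2) (by positivity)
    obtain ⟨ρy, hρy, Cy, hCy, hy⟩ := hyS
    set σ := min ρy (ρ / 2) with hσ
    have hσ0 : 0 < σ := by positivity
    have hv := vb_pos (d := d) hσ0
    have hsub : Metric.closedBall y σ ⊆ Metric.closedBall x ρ := by
      apply Metric.closedBall_subset_closedBall'
      have := min_le_right ρy (ρ / 2)
      rw [dist_comm] at hxy
      linarith
    obtain ⟨C, hC, hC2⟩ := hLL (1 / 2 * vb d σ) (by positivity)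
    set D := max 1 (2 * Cy / vb d σ) with hD
    have hD0 : 0 < D := by positivity
    refine ⟨ρ, hρ, C * D, by positivity, fun u hu hu0 => ?_⟩
    set T := Qp p Ω V u + ∫ y in Metric.closedBall x1 ρ0, |u y| ^ p with hT
    have hI : 0 ≤ ∫ y in Metric.closedBall x1 ρ0, |u y| ^ p := integral_nonneg fun x => by positivity
    have hQu := hQ u hu
    have hT0 : 0 ≤ T := by linarith
    apply le_of_forall_pos_le_add
    intro ε' hε'
    set ε := ε' / (C * D) with hε
    have hε0 : 0 < ε := by positivity
    set δ := (D * (T + ε)) ^ (1 / p) with hδ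
    have hδ0 : 0 < δ := by positivity
    have hδp : δ ^ p = D * (T + ε) := by
      rw [hδ, ← Real.rpow_mul (by positivity), one_div_mul_cancel hp0.ne', Real.rpow_one]
    have h1 : ∫ y in Metric.closedBall x ρ, |u y| ^ p ≤ C * δ ^ p := by
      apply hC2 u hu hu0 δ hδ0
      · rw [hδp]
        have : 1 ≤ D := le_max_left _ _
        nlinarith
      · refine (cheb hp0 hu hu0 (y := y) (σ := σ) hδ0 ?_).trans (measure_mono fun z hz => ⟨hsub hz.1, hz.2⟩)
        calc ∫ z in Metric.closedBall y σ, |u z| ^ p ≤ ∫ z in Metric.closedBall y ρy, |u z| ^ p :=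
              ball_mono hp0 hu (Metric.closedBall_subset_closedBall (min_le_left _ _))
          _ ≤ Cy * T := hy u hu hu0
          _ = 1 / 2 * vb d σ * (2 * Cy / vb d σ * T) := by field_simp
          _ ≤ 1 / 2 * vb d σ * δ ^ p := by
            rw [hδp]
            gcongr
            · exact le_max_right _ _
            · linarith
    rw [hδp] at h1
    have : C * (D * (T + ε)) = C * D * T + ε' := by rw [hε]; field_simp
    linarith

/-- smooth approximate absolute value -/
def sabs (κ t : ℝ) : ℝ := Real.sqrt (t ^ 2 + κ ^ 2) - κ

lemma sabs_bounds {κ : ℝ} (hκ : 0 < κ) (t : ℝ) : 0 ≤ sabs κ t ∧ sabs κ t ≤ |t| ∧ |t| - κ ≤ sabs κ t := by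
  unfold sabs
  refine ⟨?_, ?_, ?_⟩
  · rw [sub_nonneg]
    apply Real.le_sqrt_of_sq_le
    nlinarith [sq_nonneg t]
  · rw [sub_le_iff_le_add]
    rw [Real.sqrt_le_left (by positivity)]
    nlinarith [sq_abs t, abs_nonneg t]
  · have : |t| ≤ Real.sqrt (t ^ 2 + κ ^ 2) := by
      apply Real.le_sqrt_of_sq_le
      rw [sq_abs]; nlinarith
    linarith

lemma sabs_test {κ : ℝ} (hκ : 0 < κ) (hu : IsTestOn Ω u) :
    IsTestOn Ω (fun x => sabs κ (u x)) ∧ ∀ x, ‖fderiv ℝ (fun x => sabs κ (u x)) x‖ ≤ ‖fderiv ℝ u x‖ := by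
  have hne : ∀ x, u x ^ 2 + κ ^ 2 ≠ 0 := fun x => by positivity
  have hs : Function.support (fun x => sabs κ (u x)) ⊆ Function.support u := by
    intro x hx h0
    apply hx
    simp [sabs, h0, Real.sqrt_sq hκ.le]
  refine ⟨⟨(((hu.1.pow 2).add contDiff_const).sqrt hne).sub contDiff_const, hu.2.1.mono hs,
    (closure_mono hs).trans hu.2.2⟩, fun x => ?_⟩
  have h1 : HasFDerivAt u (fderiv ℝ u x) x := (test_diff hu x).hasFDerivAt
  have h2 := (((h1.pow 2).add_const (κ ^ 2)).sqrt (hne x)).sub_const κ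
  have h3 : HasFDerivAt (fun x => sabs κ (u x)) _ x := h2
  rw [h3.fderiv, norm_smul, norm_smul, ← mul_assoc]
  have hpos : 0 < Real.sqrt (u x ^ 2 + κ ^ 2) := Real.sqrt_pos.2 (by positivity)
  have : ‖1 / (2 * Real.sqrt (u x ^ 2 + κ ^ 2))‖ * ‖(2 • u x ^ (2 - 1) : ℝ)‖ ≤ 1 := by
    rw [Real.norm_of_nonneg (by positivity)]
    simp only [nsmul_eq_mul, Nat.cast_ofNat, norm_mul, Real.norm_ofNat, Real.norm_eq_abs, Nat.add_one_sub_one, pow_one]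
    rw [div_mul_eq_mul_div, div_le_one (by positivity), one_mul]
    gcongr
    apply Real.le_sqrt_of_sq_le
    rw [sq_abs]; nlinarith
  calc _ ≤ 1 * ‖fderiv ℝ u x‖ := by gcongr
    _ = _ := one_mul _

lemma signed (hp : 1 < p) (hV : LocBddOn Ω V) {S : Set (Ed d)} {c : ℝ}
    (h : ∀ u, IsTestOn Ω u → (∀ x, 0 ≤ u x) → c * ∫ y in S, |u y| ^ p ≤ Qp p Ω V u) (hu : IsTestOn Ω u) :
    c * ∫ y in S, |u y| ^ p ≤ Qp p Ω V u := by
  have hp0 : 0 < p := by linarith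
  set κ : ℕ → ℝ := fun n => 1 / ((n : ℝ) + 1) with hκ
  have hκ0 : ∀ n, 0 < κ n := fun n => by simp only [hκ]; positivity
  have hκt : Tendsto κ atTop (𝓝 0) := tendsto_one_div_add_atTop_nhds_zero_nat
  set v : ℕ → Ed d → ℝ := fun n x => sabs (κ n) (u x) with hv
  have hvt : ∀ n, IsTestOn Ω (v n) := fun n => (sabs_test (hκ0 n) hu).1
  have hlim : ∀ x, Tendsto (fun n => |v n x| ^ p) atTop (𝓝 (|u x| ^ p)) := by
    intro x
    have h1 : Tendsto (fun n => v n x) atTop (𝓝 |u x|) := by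
      refine tendsto_of_tendsto_of_tendsto_of_le_of_le (g := fun n => |u x| - κ n) (h := fun _ => |u x|) ?_ tendsto_const_nhds
        (fun n => (sabs_bounds (hκ0 n) (u x)).2.2) (fun n => (sabs_bounds (hκ0 n) (u x)).2.1)
      simpa using hκt.const_sub |u x|
    have h2 := (h1.abs).rpow_const (p := p) (Or.inr hp0.le)
    simpa using h2
  have hle : ∀ n x, |v n x| ^ p ≤ |u x| ^ p := fun n x => by
    apply Real.rpow_le_rpow (abs_nonneg _) _ hp0.le
    have := sabs_bounds (hκ0 n) (u x)
    rw [abs_of_nonneg this.1]; exact this.2.1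
  have L1 : Tendsto (fun n => c * ∫ y in S, |v n y| ^ p) atTop (𝓝 (c * ∫ y in S, |u y| ^ p)) := by
    apply Tendsto.const_mul
    refine tendsto_integral_of_dominated_convergence (fun x => |u x| ^ p)
      (fun n => ((abs_rpow_supp hp0 (hvt n)).1).aestronglyMeasurable) (int_pow hp0 hu).integrableOn ?_ ?_
    · exact fun n => Eventually.of_forall fun x => by
        rw [Real.norm_of_nonneg (by positivity)]; exact hle n x
    · exact Eventually.of_forall hlim
  have L2 : Tendsto (fun n => (∫ x, ‖fderiv ℝ u x‖ ^ p) + ∫ x, V x * |v n x| ^ p) atTop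
      (𝓝 ((∫ x, ‖fderiv ℝ u x‖ ^ p) + ∫ x, V x * |u x| ^ p)) := by
    apply Tendsto.const_add
    refine tendsto_integral_of_dominated_convergence (fun x => ‖V x * |u x| ^ p‖)
      (fun n => (int_Vpow hp0 hV (hvt n)).aestronglyMeasurable) (int_Vpow hp0 hV hu).norm ?_ ?_
    · refine fun n => Eventually.of_forall fun x => ?_
      rw [norm_mul, norm_mul]
      gcongr
      rw [Real.norm_of_nonneg (by positivity), Real.norm_of_nonneg (by positivity)]; exact hle n x
    · exact Eventually.of_forall fun x => (hlim x).const_mul _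
  have hfin := le_of_tendsto_of_tendsto' L1 L2 (fun n => ?_)
  · rw [Qp_eq hp0 hu, integral_add (int_grad hp0 hu) (int_Vpow hp0 hV hu)]; exact hfin
  · refine (h (v n) (hvt n) (fun x => (sabs_bounds (hκ0 n) (u x)).1)).trans ?_
    rw [Qp_eq hp0 (hvt n), integral_add (int_grad hp0 (hvt n)) (int_Vpow hp0 hV (hvt n))]
    gcongr
    · exact int_grad hp0 (hvt n)
    · exact int_grad hp0 hu
    · intro x
      exact Real.rpow_le_rpow (norm_nonneg _) ((sabs_test (hκ0 n) hu).2 x) hp0.le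

lemma build_W (hp : 1 < p) (hΩ : Ω.Nonempty)
    (hQ : NonnegOn p Ω V)
    (h : ∀ x ∈ Ω, ∃ ρ, 0 < ρ ∧ ∃ c, 0 < c ∧ ∀ u, IsTestOn Ω u → c * ∫ y in Metric.closedBall x ρ, |u y| ^ p ≤ Qp p Ω V u) :
    SubcriticalOn p Ω V := by
  have hp0 : 0 < p := by linarith
  choose! ρ hρ c hc h using h
  obtain ⟨t, htΩ, htc, hcov⟩ := TopologicalSpace.countable_cover_nhdsWithin (s := Ω) (f := fun x => Metric.ball x (ρ x))
    (fun x hx => mem_nhdsWithin_of_mem_nhds (Metric.ball_mem_nhds x (hρ x hx)))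
  have htn : t.Nonempty := by
    obtain ⟨x, hx⟩ := hΩ
    obtain ⟨y, hy, -⟩ := Set.mem_iUnion₂.1 (hcov hx)
    exact ⟨y, hy⟩
  obtain ⟨e, he⟩ := htc.exists_eq_range htn
  have heΩ : ∀ k, e k ∈ Ω := fun k => htΩ (he ▸ Set.mem_range_self k)
  set b : ℕ → Ed d → ℝ := fun k x => min 1 (max 0 (ρ (e k) - dist x (e k))) with hb
  have hb0 : ∀ k x, 0 ≤ b k x := fun k x => le_min zero_le_one (le_max_left _ _)
  have hb1 : ∀ k x, b k x ≤ 1 := fun k x => min_le_left _ _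
  have hbc : ∀ k, Continuous (b k) := fun k =>
    continuous_const.min (continuous_const.max (continuous_const.sub (continuous_id.dist continuous_const)))
  have hbz : ∀ k x, x ∉ Metric.closedBall (e k) (ρ (e k)) → b k x = 0 := fun k x hx => by
    rw [Metric.mem_closedBall, not_le] at hx
    simp only [hb]
    rw [max_eq_left (by linarith)]; simp
  set γ : ℕ → ℝ := fun k => (1 / 2 / 2 ^ k) * min (c (e k)) 1 with hγ
  have hγ0 : ∀ k, 0 < γ k := fun k => by
    have := hc (e k) (heΩ k)
    simp only [hγ]; positivity
  have hγ1 : ∀ k, γ k ≤ 1 / 2 / 2 ^ k := fun k => by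
    simp only [hγ]
    have : min (c (e k)) 1 ≤ 1 := min_le_right _ _
    have h2 : (0:ℝ) ≤ 1 / 2 / 2 ^ k := by positivity
    nlinarith
  have hsum : Summable (fun k : ℕ => (1:ℝ) / 2 / 2 ^ k) := summable_geometric_two' 1
  have hWs : ∀ x, Summable (fun k => γ k * b k x) := fun x =>
    Summable.of_nonneg_of_le (fun k => mul_nonneg (hγ0 k).le (hb0 k x))
      (fun k => (mul_le_of_le_one_right (hγ0 k).le (hb1 k x)).trans (hγ1 k)) hsum
  refine ⟨fun x => ∑' k, γ k * b k x, ?_, ?_, ?_⟩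
  · apply Continuous.continuousOn
    refine continuous_tsum (fun k => continuous_const.mul (hbc k)) hsum (fun k x => ?_)
    rw [Real.norm_of_nonneg (mul_nonneg (hγ0 k).le (hb0 k x))]
    exact (mul_le_of_le_one_right (hγ0 k).le (hb1 k x)).trans (hγ1 k)
  · intro x hx
    obtain ⟨y, hy, hxy⟩ := Set.mem_iUnion₂.1 (hcov hx)
    rw [he] at hy
    obtain ⟨k, rfl⟩ := hy
    refine (hWs x).tsum_pos (fun k => mul_nonneg (hγ0 k).le (hb0 k x)) k (mul_pos (hγ0 k) ?_)
    rw [Metric.mem_ball] at hxy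
    exact lt_min one_pos (lt_max_of_lt_right (by linarith))
  · intro u hu
    have cu := (abs_rpow_supp hp0 hu).1
    rw [setIntegral_eq_integral_of_forall_compl_eq_zero (fun x hx => by
      have hx' : x ∉ tsupport u := fun h => hx (hu.2.2 h)
      rw [image_eq_zero_of_notMem_tsupport hx']; simp [Real.zero_rpow hp0.ne'])]
    set F : ℕ → Ed d → ℝ := fun k x => γ k * b k x * |u x| ^ p with hF
    have hFi : ∀ k, Integrable (F k) := fun k => by
      apply ((continuous_const.mul (hbc k)).mul cu).integrable_of_hasCompactSupport
      exact (abs_rpow_supp hp0 hu).2.1.mul_left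
    have hF0 : ∀ k x, 0 ≤ F k x := fun k x => mul_nonneg (mul_nonneg (hγ0 k).le (hb0 k x)) (by positivity)
    have hFle : ∀ k, ∫ x, F k x ≤ Qp p Ω V u * (1 / 2 / 2 ^ k) := by
      intro k
      have h1 : ∫ x, F k x ≤ ∫ x, (Metric.closedBall (e k) (ρ (e k))).indicator (fun x => γ k * |u x| ^ p) x := by
        refine integral_mono (hFi k) (ind_cont_int (continuous_const.mul cu) _ _) (fun x => ?_)
        by_cases hx : x ∈ Metric.closedBall (e k) (ρ (e k))
        · rw [Set.indicator_of_mem hx]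
          simp only [hF]
          have := hγ0 k
          have := hb1 k x
          gcongr
          nlinarith
        · rw [Set.indicator_of_notMem hx]
          simp only [hF]
          rw [hbz k x hx]; simp
      rw [integral_indicator measurableSet_closedBall, integral_const_mul] at h1
      have h2 := h (e k) (heΩ k) u hu
      have hI : 0 ≤ ∫ x in Metric.closedBall (e k) (ρ (e k)), |u x| ^ p := integral_nonneg fun x => by positivity
      refine h1.trans ?_
      simp only [hγ]
      rw [mul_assoc, mul_comm (Qp p Ω V u)]
      gcongr
      refine le_trans ?_ h2
      gcongr
      exact min_le_left _ _
    have hs := hasSum_integral_of_summable_integral_norm hFi (Summable.of_nonneg_of_le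
      (fun k => integral_nonneg fun x => norm_nonneg _) (fun k => by
        have : ∫ x, ‖F k x‖ = ∫ x, F k x := by
          congr 1; ext x; exact Real.norm_of_nonneg (hF0 k x)
        rw [this]; exact hFle k) (hsum.mul_left _))
    have e1 : ∀ x, (∑' k, γ k * b k x) * |u x| ^ p = ∑' k, F k x := fun x => by
      simp only [hF]; rw [tsum_mul_right]
    simp only [e1]
    rw [← hs.tsum_eq]
    calc _ ≤ ∑' k : ℕ, Qp p Ω V u * (1 / 2 / 2 ^ k) := hs.summable.tsum_le_tsum hFle (hsum.mul_left _)
      _ = _ := by rw [tsum_mul_left, tsum_geometric_two' 1]; simp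



lemma fo {E : Type*} [NormedAddCommGroup E] [InnerProductSpace ℝ E] [FiniteDimensional ℝ E]
    (hp : 1 < p) {ε : ℝ} (hε : 0 < ε) : ∃ t0 : ℝ, 0 < t0 ∧ ∀ t, 0 < t → t ≤ t0 → ∀ a b : E,
    |‖a + t • b‖ ^ p - ‖a‖ ^ p - t * (p * ‖a‖ ^ (p - 2) * ⟪a, b⟫)| ≤ ε * t * (‖a‖ ^ p + ‖b‖ ^ p) := by
  have hp0 : 0 < p := by linarith
  set f : E → ℝ := fun x => ‖x‖ ^ p with hf
  have hfc : ContDiff ℝ 1 f := contDiff_norm_rpow hp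
  have hfd : Differentiable ℝ f := hfc.differentiable one_ne_zero
  have hc : Continuous (fderiv ℝ f) := hfc.continuous_fderiv one_ne_zero
  have huc : UniformContinuousOn (fderiv ℝ f) (Metric.closedBall 0 2) :=
    (isCompact_closedBall _ _).uniformContinuousOn_of_continuous hc.continuousOn
  rw [Metric.uniformContinuousOn_iff] at huc
  obtain ⟨δ, hδ, huc⟩ := huc ε hε
  refine ⟨min 1 (δ / 2), by positivity, fun t ht htt => ?_⟩
  have ht1 : t ≤ 1 := htt.trans (min_le_left _ _)
  have ht2 : t < δ := by have := htt.trans (min_le_right _ _); linarith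
  -- the unit case
  have key : ∀ a b : E, ‖a‖ ≤ 1 → ‖b‖ ≤ 1 →
      |‖a + t • b‖ ^ p - ‖a‖ ^ p - t * (p * ‖a‖ ^ (p - 2) * ⟪a, b⟫)| ≤ ε * t := by
    intro a b ha hb
    have hn : ‖t • b‖ ≤ t := by
      rw [norm_smul, Real.norm_of_nonneg ht.le]; nlinarith
    have h := (convex_segment a (a + t • b)).norm_image_sub_le_of_norm_fderiv_le' (𝕜 := ℝ) (f := f)
      (φ := fderiv ℝ f a) (C := ε) (fun x _ => hfd x) ?_ (left_mem_segment ℝ _ _) (right_mem_segment ℝ _ _)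
    · rw [hf, fderiv_norm_rpow a hp] at h
      simp only [add_sub_cancel_left, Real.norm_eq_abs] at h
      have e : ((p * ‖a‖ ^ (p - 2)) • (innerSL ℝ) a) (t • b) = t * (p * ‖a‖ ^ (p - 2) * ⟪a, b⟫) := by
        simp
      rw [e] at h
      refine h.trans ?_
      gcongr
    · intro x hx
      obtain ⟨l, hl, rfl⟩ := (segment_eq_image' ℝ a (a + t • b)) ▸ hx
      simp only [add_sub_cancel_left]
      have h1 : ‖l • t • b‖ ≤ t := by
        rw [norm_smul, Real.norm_of_nonneg hl.1]
        have := hl.2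
        nlinarith [norm_nonneg (t • b), hl.1]
      rw [← dist_eq_norm]
      refine (huc _ ?_ _ ?_ ?_).le
      · rw [mem_closedBall_zero_iff]
        exact (norm_add_le _ _).trans (by linarith)
      · rw [mem_closedBall_zero_iff]; linarith
      · rw [dist_eq_norm, add_sub_cancel_left]; linarith
  intro a b
  set m := max ‖a‖ ‖b‖ with hm
  rcases (le_max_of_le_left (norm_nonneg a) : 0 ≤ m).eq_or_lt with h0 | h0
  · have ha : a = 0 := by
      have := le_max_left ‖a‖ ‖b‖
      exact norm_le_zero_iff.1 (this.trans h0.ge)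
    have hb : b = 0 := by
      have := le_max_right ‖a‖ ‖b‖
      exact norm_le_zero_iff.1 (this.trans h0.ge)
    subst ha hb
    simp [Real.zero_rpow hp0.ne']
  · have h := key (m⁻¹ • a) (m⁻¹ • b) ?_ ?_
    · have hsc : ∀ x : E, ‖m⁻¹ • x‖ = m⁻¹ * ‖x‖ := fun x => by
        rw [norm_smul, Real.norm_of_nonneg (by positivity)]
      have e1 : m⁻¹ • a + t • m⁻¹ • b = m⁻¹ • (a + t • b) := by
        rw [smul_add, smul_comm]
      have hmi : 0 < m⁻¹ := by positivity
      rw [e1, hsc, hsc, Real.mul_rpow hmi.le (norm_nonneg _), Real.mul_rpow hmi.le (norm_nonneg _),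
        Real.mul_rpow hmi.le (norm_nonneg _), inner_smul_left, inner_smul_right] at h
      have e2 : (m⁻¹) ^ p = (m⁻¹) ^ (p - 2) * m⁻¹ * m⁻¹ := by
        rw [mul_assoc, ← sq, ← Real.rpow_natCast, ← Real.rpow_add hmi]; norm_num
      have e3 : (m⁻¹) ^ p * ‖a + t • b‖ ^ p - (m⁻¹) ^ p * ‖a‖ ^ p -
          t * (p * ((m⁻¹) ^ (p - 2) * ‖a‖ ^ (p - 2)) * ((starRingEnd ℝ) m⁻¹ * (m⁻¹ * ⟪a, b⟫))) =
          (m⁻¹) ^ p * (‖a + t • b‖ ^ p - ‖a‖ ^ p - t * (p * ‖a‖ ^ (p - 2) * ⟪a, b⟫)) := by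
        rw [e2]; simp; ring
      rw [e3, abs_mul, abs_of_pos (by positivity), Real.inv_rpow h0.le, inv_mul_le_iff₀ (by positivity)] at h
      refine h.trans ?_
      have : m ^ p ≤ ‖a‖ ^ p + ‖b‖ ^ p := by
        rcases max_choice ‖a‖ ‖b‖ with h | h
        · rw [hm, h]; have : 0 ≤ ‖b‖ ^ p := by positivity
          linarith
        · rw [hm, h]; have : 0 ≤ ‖a‖ ^ p := by positivity
          linarith
      calc m ^ p * (ε * t) ≤ (‖a‖ ^ p + ‖b‖ ^ p) * (ε * t) := by gcongr
        _ = _ := by ring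
    · rw [norm_smul, Real.norm_of_nonneg (by positivity), inv_mul_le_iff₀ h0, mul_one]; exact le_max_left _ _
    · rw [norm_smul, Real.norm_of_nonneg (by positivity), inv_mul_le_iff₀ h0, mul_one]; exact le_max_right _ _

lemma fo_grad (hp : 1 < p) {ε : ℝ} (hε : 0 < ε) : ∃ t0 : ℝ, 0 < t0 ∧ ∀ t, 0 < t → t ≤ t0 →
    ∀ A B : Ed d →L[ℝ] ℝ, ‖A + t • B‖ ^ p + ‖A + t • -B‖ ^ p ≤ 2 * ‖A‖ ^ p + 2 * ε * t * (‖A‖ ^ p + ‖B‖ ^ p) := by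
  obtain ⟨t0, ht0, h⟩ := fo (E := Ed d) hp hε
  refine ⟨t0, ht0, fun t ht htt A B => ?_⟩
  set J := (InnerProductSpace.toDual ℝ (Ed d)).symm with hJ
  have h1 := (abs_le.1 (h t ht htt (J A) (J B))).2
  have h2 := (abs_le.1 (h t ht htt (J A) (-J B))).2
  have e : ∀ X, ‖J X‖ = ‖X‖ := fun X => LinearIsometryEquiv.norm_map _ X
  have e1 : J A + t • J B = J (A + t • B) := by simp [map_add]
  have e2 : J A + t • -J B = J (A + t • -B) := by simp [map_add]
  rw [e1, e, e, e] at h1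
  rw [e2, norm_neg, e, e, e, inner_neg_right] at h2
  nlinarith

lemma fo_real (hp : 1 < p) {ε : ℝ} (hε : 0 < ε) : ∃ t0 : ℝ, 0 < t0 ∧ ∀ t, 0 < t → t ≤ t0 →
    ∀ a b : ℝ, 0 ≤ a → |(|a + t * b| ^ p - |a| ^ p - t * (p * a ^ (p - 1) * b))| ≤ ε * t * (|a| ^ p + |b| ^ p) := by
  obtain ⟨t0, ht0, h⟩ := fo (E := ℝ) hp hε
  refine ⟨t0, ht0, fun t ht htt a b ha => ?_⟩
  have := h t ht htt a b
  simp only [Real.norm_eq_abs, smul_eq_mul] at this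
  have e : |a| ^ (p - 2) * inner ℝ a b = a ^ (p - 1) * b := by
    rw [abs_of_nonneg ha]
    rcases ha.eq_or_lt with h | h
    · subst h; rw [Real.zero_rpow (by linarith : p - 1 ≠ 0)]; simp
    · have : a ^ (p - 1) = a ^ (p - 2) * a := by rw [← Real.rpow_add_one h.ne']; congr 1; ring
      rw [this]; simp; ring
  rwa [mul_assoc p, e, ← mul_assoc p] at this

lemma young {a w τ : ℝ} (hp : 1 < p) (ha : 0 ≤ a) (hw : 0 ≤ w) (hτ : 0 < τ) :
    a ^ (p - 1) * w ≤ τ * a ^ p + τ ^ (1 - p) * w ^ p := by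
  have h1 : 0 ≤ τ * a ^ p := by positivity
  have h2 : 0 ≤ τ ^ (1 - p) * w ^ p := by positivity
  have e : ∀ x : ℝ, 0 ≤ x → x ^ p = x ^ (p - 1) * x := fun x hx => by
    rw [← Real.rpow_add_one' hx (by linarith)]; congr 1; ring
  rcases le_total w (τ * a) with h | h
  · have : a ^ (p - 1) * w ≤ a ^ (p - 1) * (τ * a) := by gcongr
    rw [e a ha] at *
    nlinarith
  · have h3 : a ≤ w / τ := by rw [le_div_iff₀ hτ]; linarith
    have : a ^ (p - 1) * w ≤ (w / τ) ^ (p - 1) * w := by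
      have : 0 ≤ p - 1 := by linarith
      gcongr
    rw [Real.div_rpow hw hτ.le] at this
    have e2 : τ ^ (1 - p) = (τ ^ (p - 1))⁻¹ := by rw [← Real.rpow_neg hτ.le]; congr 1; ring
    rw [e2, e w hw] at *
    have : w ^ (p - 1) / τ ^ (p - 1) * w = (τ ^ (p - 1))⁻¹ * (w ^ (p - 1) * w) := by ring
    linarith


lemma approx (hp : 1 < p) {x1 : Ed d} {r r' : ℝ} (hr : 0 < r) (hrr : r < r')
    (hb : Metric.closedBall x1 r' ⊆ Ω) {σ : Ed d → ℝ} (hσm : Measurable σ) (hσ : ∀ x, |σ x| ≤ 1)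
    {ω : ℝ} (hω : 0 < ω) :
    ∃ φ, IsTestOn Ω φ ∧ tsupport φ ⊆ Metric.closedBall x1 r' ∧
      Integrable (fun x => |(Metric.closedBall x1 r).indicator σ x - φ x| ^ p) ∧
      ∫ x, |(Metric.closedBall x1 r).indicator σ x - φ x| ^ p ≤ ω := by
  have hp0 : 0 < p := by linarith
  set f := (Metric.closedBall x1 r).indicator σ with hf
  have hfm : Measurable f := hσm.indicator measurableSet_closedBall
  have hfL : MemLp f (ENNReal.ofReal p) := by
    have : MemLp σ (ENNReal.ofReal p) (volume.restrict (Metric.closedBall x1 r)) := by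
      have : IsFiniteMeasure (volume.restrict (Metric.closedBall x1 r)) :=
        ⟨by rw [Measure.restrict_apply_univ]; exact measure_closedBall_lt_top⟩
      exact MemLp.of_bound hσm.aestronglyMeasurable 1 (Eventually.of_forall fun x => hσ x)
    exact (memLp_indicator_iff_restrict measurableSet_closedBall).2 this
  have I : 0 < ω ^ (1 / p) := Real.rpow_pos_of_pos hω _
  have B : ENNReal.ofReal p ≠ 0 := by simpa using hp0
  obtain ⟨g, hgc, hgs, hg⟩ := hfL.exist_eLpNorm_sub_le ENNReal.ofReal_ne_top
    (by rw [← ENNReal.ofReal_one]; exact ENNReal.ofReal_le_ofReal hp.le) I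
  have g_mem : MemLp g (ENNReal.ofReal p) := hgs.continuous.memLp_of_hasCompactSupport hgc
  have hint : Integrable (fun x => |f x - g x| ^ p) := by
    have := (hfL.sub g_mem).integrable_norm_rpow B ENNReal.ofReal_ne_top
    rw [ENNReal.toReal_ofReal hp0.le] at this
    exact this
  rw [(hfL.sub g_mem).eLpNorm_eq_integral_rpow_norm B ENNReal.ofReal_ne_top,
    ENNReal.ofReal_le_ofReal_iff I.le, one_div, ENNReal.toReal_ofReal hp0.le,
    Real.rpow_le_rpow_iff (by positivity) hω.le (inv_pos.2 hp0)] at hg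
  obtain ⟨C0, -, hcut⟩ := exists_cut
  obtain ⟨χ, hχ⟩ := hcut d x1 r r' hr hrr
  have hφ : IsTestOn Ω (fun x => χ x ^ 1 * g x) := cut_test hχ hb le_rfl hgs
  simp only [pow_one] at hφ
  have hle : ∀ x, |f x - χ x * g x| ^ p ≤ |f x - g x| ^ p := by
    intro x
    have e : f x - χ x * g x = χ x * (f x - g x) := by
      by_cases hx : x ∈ Metric.closedBall x1 r
      · rw [hχ.one x hx]; ring
      · rw [hf, Set.indicator_of_notMem hx]; ring
    rw [e, abs_mul, abs_of_nonneg (hχ.nonneg x)]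
    refine Real.rpow_le_rpow (mul_nonneg (hχ.nonneg x) (abs_nonneg _)) ?_ hp0.le
    exact mul_le_of_le_one_left (abs_nonneg _) (hχ.le_one x)
  have hi2 : Integrable (fun x => |f x - χ x * g x| ^ p) := by
    refine hint.mono' ?_ (Eventually.of_forall fun x => ?_)
    · exact ((hfm.sub (hχ.smooth.continuous.mul hgs.continuous).measurable).abs.pow_const p).aestronglyMeasurable
    · rw [Real.norm_of_nonneg (by positivity)]; exact hle x
  refine ⟨_, hφ, (tsupport_mul_subset_left).trans hχ.supp, hi2, ?_⟩
  exact (integral_mono hi2 hint hle).trans hg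

lemma pert (hp : 1 < p) {V₀ V₁ φ : Ed d → ℝ} (hV₀ : LocBddOn Ω V₀) (hV₁ : LocBddOn Ω V₁)
    (hQ₀ : NonnegOn p Ω V₀) (hQ₁ : NonnegOn p Ω V₁) {x1 : Ed d} {r M ε : ℝ} (hM0 : 0 ≤ M)
    (hM₀ : ∀ᵐ x, x ∈ Metric.closedBall x1 r → |V₀ x| ≤ M)
    (hM₁ : ∀ᵐ x, x ∈ Metric.closedBall x1 r → |V₁ x| ≤ M)
    (hφ : IsTestOn Ω φ) (hφs : tsupport φ ⊆ Metric.closedBall x1 r) (hε : 0 < ε) :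
    ∃ t : ℝ, 0 < t ∧ ∀ u, IsTestOn Ω u → (∀ x, 0 ≤ u x) →
      t * p * ∫ x, (V₀ x - V₁ x) * (u x ^ (p - 1) * φ x) ≤ Qp p Ω V₀ u + Qp p Ω V₁ u +
        ε * t * (2 * (∫ x in Metric.closedBall x1 r, (‖fderiv ℝ u x‖ ^ p + ‖fderiv ℝ φ x‖ ^ p)) +
          2 * M * ∫ x in Metric.closedBall x1 r, (|u x| ^ p + |φ x| ^ p)) := by
  have hp0 : 0 < p := by linarith
  obtain ⟨t1, ht1, h1⟩ := fo_grad (d := d) hp hε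
  obtain ⟨t2, ht2, h2⟩ := fo_real hp hε
  set t := min t1 t2 with htdef
  have ht : 0 < t := lt_min ht1 ht2
  refine ⟨t, ht, fun u hu hu0 => ?_⟩
  replace h1 := h1 t ht (min_le_left _ _)
  replace h2 := h2 t ht (min_le_right _ _)
  have hp1 := test_add hu (test_smul t hφ)
  have hp2 := test_add hu (test_smul (-t) hφ)
  have q1 := hQ₁ _ hp1
  have q2 := hQ₀ _ hp2
  rw [Qp_eq hp0 hp1] at q1
  rw [Qp_eq hp0 hp2] at q2
  rw [Qp_eq hp0 hu, Qp_eq hp0 hu]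
  set S := Metric.closedBall x1 r with hS
  have cg : Continuous fun x => ‖fderiv ℝ u x‖ ^ p + ‖fderiv ℝ φ x‖ ^ p :=
    ((test_fcont hu).norm.rpow_const (fun x => Or.inr hp0.le)).add
      ((test_fcont hφ).norm.rpow_const (fun x => Or.inr hp0.le))
  have cz : Continuous fun x => |u x| ^ p + |φ x| ^ p := (abs_rpow_supp hp0 hu).1.add (abs_rpow_supp hp0 hφ).1
  rw [← integral_indicator measurableSet_closedBall, ← integral_indicator measurableSet_closedBall]
  have i1 := ind_cont_int cg x1 r
  have i2 := ind_cont_int cz x1 r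
  have cl : Continuous fun x => u x ^ (p - 1) * φ x :=
    ((test_cont hu).rpow_const (fun x => Or.inr (by linarith))).mul (test_cont hφ)
  have sl : tsupport (fun x => u x ^ (p - 1) * φ x) ⊆ tsupport φ := tsupport_mul_subset_right
  have cc : HasCompactSupport (fun x => u x ^ (p - 1) * φ x) := hφ.2.1.mul_left
  have i3 : Integrable (fun x => (V₀ x - V₁ x) * (u x ^ (p - 1) * φ x)) := by
    have := (int_V hV₀ cl cc (sl.trans hφ.2.2)).sub (int_V hV₁ cl cc (sl.trans hφ.2.2))
    refine this.congr (Eventually.of_forall fun x => ?_)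
    simp only [Pi.sub_apply]; ring
  have i4 := int_dens hp0 hV₀ hu
  have i5 := int_dens hp0 hV₁ hu
  have i6 := int_dens hp0 hV₁ hp1
  have i7 := int_dens hp0 hV₀ hp2
  rw [← integral_const_mul, ← integral_const_mul, ← integral_const_mul,
    ← integral_add (i1.const_mul _) (i2.const_mul _), ← integral_const_mul,
    ← integral_add i4 i5]
  have hsum : ∫ x, (t * p * ((V₀ x - V₁ x) * (u x ^ (p - 1) * φ x))) ≤
      ∫ x, (t * p * ((V₀ x - V₁ x) * (u x ^ (p - 1) * φ x)) +
        ((‖fderiv ℝ (fun x => u x + t * φ x) x‖ ^ p + V₁ x * |u x + t * φ x| ^ p) +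
        (‖fderiv ℝ (fun x => u x + -t * φ x) x‖ ^ p + V₀ x * |u x + -t * φ x| ^ p))) := by
    refine le_trans ?_ (integral_add (i3.const_mul (t * p)) (i6.add i7)).ge
    have h67 := integral_add i6 i7
    refine le_add_of_nonneg_right ?_
    refine le_trans ?_ h67.ge
    linarith
  refine (hsum.trans (integral_mono_ae ((i3.const_mul _).add (i6.add i7))
    ((i4.add i5).add (((i1.const_mul 2).add (i2.const_mul (2 * M))).const_mul (ε * t))) ?_)).trans
    (integral_add (i4.add i5) (((i1.const_mul 2).add (i2.const_mul (2 * M))).const_mul (ε * t))).le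
  filter_upwards [hM₀, hM₁] with x m0 m1
  have df : ∀ c : ℝ, fderiv ℝ (fun x => u x + c * φ x) x = fderiv ℝ u x + c • fderiv ℝ φ x := by
    intro c
    rw [fderiv_fun_add (test_diff hu x) ((test_diff hφ x).const_mul c), fderiv_const_mul (test_diff hφ x)]
  simp only [df, Pi.add_apply]
  by_cases hx : x ∈ S
  · rw [Set.indicator_of_mem hx, Set.indicator_of_mem hx]
    have a1 := h1 (fderiv ℝ u x) (fderiv ℝ φ x)
    have a2 := h2 (u x) (φ x) (hu0 x)
    have a3 := h2 (u x) (-φ x) (hu0 x)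
    rw [smul_neg, ← neg_smul] at a1
    rw [mul_neg, ← neg_mul, abs_neg] at a3
    set X := |u x + t * φ x| ^ p
    set Y := |u x + -t * φ x| ^ p
    set U := |u x| ^ p
    set F := |φ x| ^ p
    set L := u x ^ (p - 1) * φ x
    have b2 : V₁ x * (X - U - t * (p * L)) ≤ M * (ε * t * (U + F)) := by
      refine (le_abs_self _).trans ?_
      rw [abs_mul]
      have : p * u x ^ (p - 1) * φ x = p * L := by simp only [L]; ring
      rw [this] at a2
      exact mul_le_mul (m1 hx) a2 (abs_nonneg _) hM0
    have b3 : V₀ x * (Y - U + t * (p * L)) ≤ M * (ε * t * (U + F)) := by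
      refine (le_abs_self _).trans ?_
      rw [abs_mul]
      have : t * (p * u x ^ (p - 1) * -φ x) = - (t * (p * L)) := by simp only [L]; ring
      rw [this, sub_neg_eq_add] at a3
      exact mul_le_mul (m0 hx) a3 (abs_nonneg _) hM0
    linarith
  · rw [Set.indicator_of_notMem hx, Set.indicator_of_notMem hx]
    have z1 : φ x = 0 := image_eq_zero_of_notMem_tsupport (fun h => hx (hφs h))
    have z2 : fderiv ℝ φ x = 0 := by
      by_contra h
      exact hx (hφs (support_fderiv_subset ℝ h))
    rw [z1, z2]
    simp
    linarith


lemma int_lin (hp : 1 < p) {V₀ V₁ φ : Ed d → ℝ} (hV₀ : LocBddOn Ω V₀) (hV₁ : LocBddOn Ω V₁)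
    (hφ : IsTestOn Ω φ) (hu : IsTestOn Ω u) :
    Integrable (fun x => (V₀ x - V₁ x) * (u x ^ (p - 1) * φ x)) := by
  have cl : Continuous fun x => u x ^ (p - 1) * φ x :=
    ((test_cont hu).rpow_const (fun x => Or.inr (by linarith))).mul (test_cont hφ)
  have sl : tsupport (fun x => u x ^ (p - 1) * φ x) ⊆ tsupport φ := tsupport_mul_subset_right
  have cc : HasCompactSupport (fun x => u x ^ (p - 1) * φ x) := hφ.2.1.mul_left
  have := (int_V hV₀ cl cc (sl.trans hφ.2.2)).sub (int_V hV₁ cl cc (sl.trans hφ.2.2))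
  refine this.congr (Eventually.of_forall fun x => ?_)
  simp only [Pi.sub_apply]; ring

lemma lowerb (hp : 1 < p) {V₀ V₁ φ σ : Ed d → ℝ} (hV₀ : LocBddOn Ω V₀) (hV₁ : LocBddOn Ω V₁)
    {x1 : Ed d} {r ρ M κ δ τ ω : ℝ} (hrρ : r ≤ ρ) (hM0 : 0 ≤ M)
    (hM₀ : ∀ᵐ x, x ∈ Metric.closedBall x1 ρ → |V₀ x| ≤ M)
    (hM₁ : ∀ᵐ x, x ∈ Metric.closedBall x1 ρ → |V₁ x| ≤ M)
    (hφ : IsTestOn Ω φ) (hφs : tsupport φ ⊆ Metric.closedBall x1 ρ)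
    (hσ : ∀ x, (V₀ x - V₁ x) * σ x = |V₀ x - V₁ x|)
    (hi : Integrable (fun x => |(Metric.closedBall x1 r).indicator σ x - φ x| ^ p))
    (hω : ∫ x, |(Metric.closedBall x1 r).indicator σ x - φ x| ^ p ≤ ω)
    (hκ : 0 ≤ κ) (hδ : 0 ≤ δ) (hτ : 0 < τ) (hu : IsTestOn Ω u) (hu0 : ∀ x, 0 ≤ u x)
    {A : Set (Ed d)} (hAm : MeasurableSet A) (hAs : A ⊆ Metric.closedBall x1 r)
    (hA1 : ∀ x ∈ A, κ ≤ |V₀ x - V₁ x|) (hA2 : ∀ x ∈ A, δ ≤ u x) :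
    κ * δ ^ (p - 1) * volume.real A - 2 * M * (τ * (∫ x in Metric.closedBall x1 ρ, |u x| ^ p) + τ ^ (1 - p) * ω) ≤
      ∫ x, (V₀ x - V₁ x) * (u x ^ (p - 1) * φ x) := by
  have hp0 : 0 < p := by linarith
  have hp1 : 0 ≤ p - 1 := by linarith
  have i3 := int_lin hp hV₀ hV₁ hφ hu
  set f := (Metric.closedBall x1 r).indicator σ with hf
  have hB : Metric.closedBall x1 r ⊆ Metric.closedBall x1 ρ := Metric.closedBall_subset_closedBall hrρ
  have iA : Integrable (A.indicator fun _ => κ * δ ^ (p - 1)) := by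
    rw [integrable_indicator_iff hAm]
    exact integrableOn_const ((measure_mono hAs).trans_lt measure_closedBall_lt_top).ne
  have iu : Integrable ((Metric.closedBall x1 ρ).indicator fun x => |u x| ^ p) :=
    ind_cont_int (abs_rpow_supp hp0 hu).1 x1 ρ
  have iS : Integrable (fun x => 2 * M * (τ * (Metric.closedBall x1 ρ).indicator (fun x => |u x| ^ p) x +
      τ ^ (1 - p) * |f x - φ x| ^ p)) := ((iu.const_mul _).add (hi.const_mul _)).const_mul _
  have e1 : ∫ x, A.indicator (fun _ => κ * δ ^ (p - 1)) x = κ * δ ^ (p - 1) * volume.real A := by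
    rw [integral_indicator hAm, setIntegral_const, smul_eq_mul, mul_comm]
  have e2 : ∫ x, 2 * M * (τ * (Metric.closedBall x1 ρ).indicator (fun x => |u x| ^ p) x +
      τ ^ (1 - p) * |f x - φ x| ^ p) = 2 * M * (τ * (∫ x in Metric.closedBall x1 ρ, |u x| ^ p) +
        τ ^ (1 - p) * ∫ x, |f x - φ x| ^ p) := by
    rw [integral_const_mul, integral_add (iu.const_mul _) (hi.const_mul _), integral_const_mul, integral_const_mul,
      integral_indicator measurableSet_closedBall]
  have hmain : ∫ x, (A.indicator (fun _ => κ * δ ^ (p - 1)) x -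
      2 * M * (τ * (Metric.closedBall x1 ρ).indicator (fun x => |u x| ^ p) x +
      τ ^ (1 - p) * |f x - φ x| ^ p)) ≤ ∫ x, (V₀ x - V₁ x) * (u x ^ (p - 1) * φ x) := by
    refine integral_mono_ae (iA.sub iS) i3 ?_
    filter_upwards [hM₀, hM₁] with x m0 m1
    have hy := young (p := p) (a := u x) (w := |f x - φ x|) hp (hu0 x) (abs_nonneg _) hτ
    by_cases hx : x ∈ Metric.closedBall x1 ρ
    · rw [Set.indicator_of_mem hx]
      rw [abs_of_nonneg (hu0 x)]
      have hD : |V₀ x - V₁ x| ≤ 2 * M := (abs_sub _ _).trans (by linarith [m0 hx, m1 hx])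
      have hup : 0 ≤ u x ^ (p - 1) := Real.rpow_nonneg (hu0 x) _
      have b1 : (V₀ x - V₁ x) * (u x ^ (p - 1) * (f x - φ x)) ≤
          2 * M * (τ * u x ^ p + τ ^ (1 - p) * |f x - φ x| ^ p) := by
        refine (le_abs_self _).trans ?_
        rw [abs_mul, abs_mul, abs_of_nonneg hup]
        exact mul_le_mul hD hy (by positivity) (by positivity)
      have b2 : A.indicator (fun _ => κ * δ ^ (p - 1)) x ≤ (V₀ x - V₁ x) * f x * u x ^ (p - 1) := by
        have hfx : 0 ≤ (V₀ x - V₁ x) * f x := by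
          by_cases hr : x ∈ Metric.closedBall x1 r
          · rw [hf, Set.indicator_of_mem hr, hσ]; positivity
          · rw [hf, Set.indicator_of_notMem hr]; simp
        by_cases hxA : x ∈ A
        · rw [Set.indicator_of_mem hxA, hf, Set.indicator_of_mem (hAs hxA), hσ]
          exact mul_le_mul (hA1 x hxA) (Real.rpow_le_rpow hδ (hA2 x hxA) hp1) (by positivity) (abs_nonneg _)
        · rw [Set.indicator_of_notMem hxA]; positivity
      linarith
    · have hxr : x ∉ Metric.closedBall x1 r := fun h => hx (hB h)
      have z1 : φ x = 0 := image_eq_zero_of_notMem_tsupport (fun h => hx (hφs h))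
      rw [Set.indicator_of_notMem hx, Set.indicator_of_notMem (fun h => hxr (hAs h)), z1]
      have : 0 ≤ τ ^ (1 - p) * |f x - 0| ^ p := by positivity
      have : 0 ≤ 2 * M * (τ * 0 + τ ^ (1 - p) * |f x - 0| ^ p) := by positivity
      simp only [mul_zero] at *
      linarith
  rw [integral_sub iA iS, e1, e2] at hmain
  refine le_trans ?_ hmain
  gcongr

lemma claimC_norm (hp : 1 < p) {V₀ V₁ : Ed d → ℝ} (hV₀ : LocBddOn Ω V₀) (hV₁ : LocBddOn Ω V₁)
    (hQ₀ : NonnegOn p Ω V₀) (hQ₁ : NonnegOn p Ω V₁) (hopen : IsOpen Ω)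
    (hE : 0 < volume {x ∈ Ω | V₀ x ≠ V₁ x}) :
    ∃ x1 ∈ Ω, ∃ ρ : ℝ, 0 < ρ ∧ ∃ η : ℝ, 0 < η ∧ ∀ u, IsTestOn Ω u → (∀ x, 0 ≤ u x) →
      ∫ x in Metric.closedBall x1 ρ, |u x| ^ p = 1 → η ≤ Qp p Ω V₀ u + Qp p Ω V₁ u := by
  have hp0 : 0 < p := by linarith
  obtain ⟨x1, hx1, hpos⟩ := exists_mem_forall_mem_nhdsWithin_pos_measure hE.ne'
  obtain ⟨R0, hR0, hb⟩ := Metric.nhds_basis_closedBall.mem_iff.1 (hopen.mem_nhds hx1.1)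
  obtain ⟨ρ, hρ, hρR, hLL⟩ := LL hp hV₀ hQ₀ hR0 hb
  have hbρ : Metric.closedBall x1 ρ ⊆ Ω := (Metric.closedBall_subset_closedBall hρR).trans hb
  refine ⟨x1, hx1.1, ρ, hρ, ?_⟩
  obtain ⟨M0, hM0⟩ := hV₀.2 _ (isCompact_closedBall x1 ρ) hbρ
  obtain ⟨M1, hM1⟩ := hV₁.2 _ (isCompact_closedBall x1 ρ) hbρ
  set M := max (max M0 M1) 1 with hM
  have hMpos : 0 < M := lt_of_lt_of_le one_pos (le_max_right _ _)
  replace hM0 : ∀ᵐ x, x ∈ Metric.closedBall x1 ρ → |V₀ x| ≤ M := by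
    filter_upwards [hM0] with x hx h
    exact (hx h).trans ((le_max_left _ _).trans (le_max_left _ _))
  replace hM1 : ∀ᵐ x, x ∈ Metric.closedBall x1 ρ → |V₁ x| ≤ M := by
    filter_upwards [hM1] with x hx h
    exact (hx h).trans ((le_max_right _ _).trans (le_max_left _ _))
  -- the set where the potentials differ substantially
  set D : Ed d → ℝ := fun x => V₀ x - V₁ x with hD
  have hDm : Measurable D := hV₀.1.sub hV₁.1
  obtain ⟨κ, hκ, hE1⟩ : ∃ κ : ℝ, 0 < κ ∧ 0 < volume (Metric.closedBall x1 (ρ / 2) ∩ {x | κ ≤ |D x|}) := by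
    have h1 : 0 < volume (Metric.closedBall x1 (ρ / 2) ∩ {x ∈ Ω | V₀ x ≠ V₁ x}) :=
      hpos _ (Filter.inter_mem (mem_nhdsWithin_of_mem_nhds (Metric.closedBall_mem_nhds x1 (by positivity)))
        self_mem_nhdsWithin)
    have h2 : Metric.closedBall x1 (ρ / 2) ∩ {x ∈ Ω | V₀ x ≠ V₁ x} ⊆
        ⋃ n : ℕ, Metric.closedBall x1 (ρ / 2) ∩ {x | 1 / ((n : ℝ) + 1) ≤ |D x|} := by
      rintro x ⟨hx, hx2⟩
      have : 0 < |D x| := abs_pos.2 (sub_ne_zero.2 hx2.2)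
      obtain ⟨n, hn⟩ := exists_nat_one_div_lt this
      exact Set.mem_iUnion.2 ⟨n, hx, hn.le⟩
    obtain ⟨n, hn⟩ := exists_measure_pos_of_not_measure_iUnion_null (h1.trans_le (measure_mono h2)).ne'
    exact ⟨1 / ((n : ℝ) + 1), by positivity, hn⟩
  set E1 := Metric.closedBall x1 (ρ / 2) ∩ {x | κ ≤ |D x|} with hE1d
  have hE1m : MeasurableSet E1 := measurableSet_closedBall.inter (measurableSet_le measurable_const hDm.abs)
  have hE1f : volume E1 ≠ ⊤ := ((measure_mono Set.inter_subset_left).trans_lt measure_closedBall_lt_top).ne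
  set θ := volume.real E1 / 2 with hθ
  have hθ0 : 0 < θ := by
    have : 0 < volume.real E1 := ENNReal.toReal_pos hE1.ne' hE1f
    positivity
  obtain ⟨C, hC, hLL⟩ := hLL θ hθ0
  obtain ⟨δ, hδ, hCδ⟩ : ∃ δ : ℝ, 0 < δ ∧ C * δ ^ p < 1 := by
    refine ⟨(1 / (2 * C)) ^ (1 / p), by positivity, ?_⟩
    rw [← Real.rpow_mul (by positivity), one_div_mul_cancel hp0.ne', Real.rpow_one]
    field_simp; norm_num
  set b := κ * δ ^ (p - 1) * θ with hbdef
  have hb0 : 0 < b := by positivity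
  set τ := b / (8 * M) with hτ
  have hτ0 : 0 < τ := by positivity
  set ω := b / (8 * M * τ ^ (1 - p)) with hω
  have hω0 : 0 < ω := by positivity
  set σ : Ed d → ℝ := fun x => if 0 ≤ D x then 1 else -1 with hσ
  have hσm : Measurable σ := Measurable.ite (measurableSet_le measurable_const hDm) measurable_const measurable_const
  have hσ1 : ∀ x, |σ x| ≤ 1 := fun x => by simp only [hσ]; split_ifs <;> simp
  have hσD : ∀ x, D x * σ x = |D x| := fun x => by
    simp only [hσ]; split_ifs with h
    · rw [abs_of_nonneg h, mul_one]
    · rw [abs_of_neg (not_le.1 h)]; ring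
  obtain ⟨φ, hφ, hφs, hφi, hφω⟩ := approx hp (x1 := x1) (r := ρ / 2) (r' := 3 * ρ / 4) (by positivity) (by linarith)
    ((Metric.closedBall_subset_closedBall (by linarith)).trans hbρ) hσm hσ1 hω0
  have hsub : Metric.closedBall x1 (3 * ρ / 4) ⊆ Metric.closedBall x1 ρ :=
    Metric.closedBall_subset_closedBall (by linarith)
  obtain ⟨K, hK, hcacc⟩ := cacc2 hp hV₀ hQ₀
  set K1 := (K / (ρ - 3 * ρ / 4)) ^ p + M with hK1
  have hK10 : 0 ≤ K1 := by
    have : 0 < ρ - 3 * ρ / 4 := by linarith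
    positivity
  set Φ1 := ∫ x in Metric.closedBall x1 (3 * ρ / 4), ‖fderiv ℝ φ x‖ ^ p with hΦ1
  set Φ2 := ∫ x in Metric.closedBall x1 (3 * ρ / 4), |φ x| ^ p with hΦ2
  have hΦ10 : 0 ≤ Φ1 := integral_nonneg fun x => by positivity
  have hΦ20 : 0 ≤ Φ2 := integral_nonneg fun x => by positivity
  set Z := 2 * (1 + K1 + Φ1) + 2 * M * (1 + Φ2) with hZ
  have hZ0 : 0 < Z := by positivity
  obtain ⟨t, ht, hpert⟩ := pert hp hV₀ hV₁ hQ₀ hQ₁ (r := 3 * ρ / 4) (ε := p * b / (4 * Z)) hMpos.le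
    (by filter_upwards [hM0] with x hx h using hx (hsub h))
    (by filter_upwards [hM1] with x hx h using hx (hsub h)) hφ hφs (by positivity)
  refine ⟨min (min 1 (δ ^ p)) (t * p * b / 8), by positivity, fun u hu hu0 hI => ?_⟩
  by_contra hcon
  push Not at hcon
  have c1 := hcon.trans_le ((min_le_left _ _).trans (min_le_left _ _))
  have c2 := hcon.trans_le ((min_le_left _ _).trans (min_le_right _ _))
  have c3 := hcon.trans_le (min_le_right _ _)
  have n0 := hQ₀ u hu
  have n1 := hQ₁ u hu
  -- mass of the good set
  have cu := test_cont hu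
  set A := E1 ∩ {x | δ < u x} with hA
  have hAm : MeasurableSet A := hE1m.inter (measurableSet_lt measurable_const cu.measurable)
  have hvol : θ ≤ volume.real A := by
    by_contra hlt
    push Not at hlt
    have h1 : volume.real E1 ≤ volume.real A + volume.real (E1 \ A) := by
      have := measureReal_union_le (μ := volume) A (E1 \ A)
      rwa [Set.union_diff_cancel Set.inter_subset_left] at this
    have h2 : θ ≤ volume.real (E1 \ A) := by linarith
    have h3 : ENNReal.ofReal θ ≤ volume {y | y ∈ Metric.closedBall x1 ρ ∧ u y ≤ δ} := by
      refine (ENNReal.ofReal_le_of_le_toReal h2).trans (measure_mono ?_)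
      rintro y ⟨hy, hyA⟩
      refine ⟨Metric.closedBall_subset_closedBall (by linarith) hy.1, ?_⟩
      by_contra h
      exact hyA ⟨hy, not_le.1 h⟩
    have := hLL u hu hu0 δ hδ (by linarith) h3
    linarith
  have hlow := lowerb hp hV₀ hV₁ (r := ρ / 2) (ρ := ρ) (κ := κ) (δ := δ) (τ := τ) (ω := ω) (A := A) (by linarith) hMpos.le
    hM0 hM1 hφ (hφs.trans hsub) hσD hφi hφω hκ.le hδ.le hτ0 hu hu0 hAm
    (fun x hx => hx.1.1) (fun x hx => hx.1.2) (fun x hx => le_of_lt hx.2)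
  rw [hI, mul_one] at hlow
  have l1 : 2 * M * (τ + τ ^ (1 - p) * ω) = b / 2 := by
    have : 2 * M * τ = b / 4 := by rw [hτ]; field_simp; norm_num
    have : 2 * M * (τ ^ (1 - p) * ω) = b / 4 := by rw [hω]; field_simp; norm_num
    linarith
  have l2 : b ≤ κ * δ ^ (p - 1) * volume.real A := by rw [hbdef]; gcongr
  have l3 : b / 2 ≤ ∫ x, (V₀ x - V₁ x) * (u x ^ (p - 1) * φ x) := by linarith
  have hpe := hpert u hu hu0
  have g1 := hcacc x1 (3 * ρ / 4) ρ M (by positivity) (by linarith) hM0 u hu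
  rw [hI, mul_one] at g1
  have g2 : ∫ x in Metric.closedBall x1 (3 * ρ / 4), |u x| ^ p ≤ 1 := hI ▸ ball_mono hp0 hu hsub
  have e1 : ∫ x in Metric.closedBall x1 (3 * ρ / 4), (‖fderiv ℝ u x‖ ^ p + ‖fderiv ℝ φ x‖ ^ p) =
      (∫ x in Metric.closedBall x1 (3 * ρ / 4), ‖fderiv ℝ u x‖ ^ p) + Φ1 :=
    integral_add (int_grad hp0 hu).integrableOn (int_grad hp0 hφ).integrableOn
  have e2 : ∫ x in Metric.closedBall x1 (3 * ρ / 4), (|u x| ^ p + |φ x| ^ p) =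
      (∫ x in Metric.closedBall x1 (3 * ρ / 4), |u x| ^ p) + Φ2 :=
    integral_add (int_pow hp0 hu).integrableOn (int_pow hp0 hφ).integrableOn
  rw [e1, e2] at hpe
  have e3 : 2 * ((∫ x in Metric.closedBall x1 (3 * ρ / 4), ‖fderiv ℝ u x‖ ^ p) + Φ1) +
      2 * M * ((∫ x in Metric.closedBall x1 (3 * ρ / 4), |u x| ^ p) + Φ2) ≤ Z := by
    have : (∫ x in Metric.closedBall x1 (3 * ρ / 4), ‖fderiv ℝ u x‖ ^ p) + Φ1 ≤ 1 + K1 + Φ1 := by linarith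
    rw [hZ]; gcongr
  have e4 : p * b / (4 * Z) * t * (2 * ((∫ x in Metric.closedBall x1 (3 * ρ / 4), ‖fderiv ℝ u x‖ ^ p) + Φ1) +
      2 * M * ((∫ x in Metric.closedBall x1 (3 * ρ / 4), |u x| ^ p) + Φ2)) ≤ p * b / (4 * Z) * t * Z := by gcongr
  have e5 : p * b / (4 * Z) * t * Z = t * p * b / 4 := by field_simp
  have e6 : t * p * (b / 2) ≤ t * p * ∫ x, (V₀ x - V₁ x) * (u x ^ (p - 1) * φ x) := by gcongr
  have e7 : 0 < t * p * b := by positivity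
  linarith

lemma claimC (hp : 1 < p) {V₀ V₁ : Ed d → ℝ} (hV₀ : LocBddOn Ω V₀) (hV₁ : LocBddOn Ω V₁)
    (hQ₀ : NonnegOn p Ω V₀) (hQ₁ : NonnegOn p Ω V₁) (hopen : IsOpen Ω)
    (hE : 0 < volume {x ∈ Ω | V₀ x ≠ V₁ x}) :
    ∃ x1 ∈ Ω, ∃ ρ : ℝ, 0 < ρ ∧ ∃ η : ℝ, 0 < η ∧ ∀ u, IsTestOn Ω u → (∀ x, 0 ≤ u x) →
      η * ∫ x in Metric.closedBall x1 ρ, |u x| ^ p ≤ Qp p Ω V₀ u + Qp p Ω V₁ u := by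
  have hp0 : 0 < p := by linarith
  obtain ⟨x1, hx1, ρ, hρ, η, hη, h⟩ := claimC_norm hp hV₀ hV₁ hQ₀ hQ₁ hopen hE
  refine ⟨x1, hx1, ρ, hρ, η, hη, fun u hu hu0 => ?_⟩
  set I := ∫ x in Metric.closedBall x1 ρ, |u x| ^ p with hI
  have hI0 : 0 ≤ I := integral_nonneg fun x => by positivity
  rcases hI0.eq_or_lt with h0 | h0
  · rw [← h0, mul_zero]; exact add_nonneg (hQ₀ u hu) (hQ₁ u hu)
  · set c := (I⁻¹) ^ (1 / p) with hc
    have hc0 : 0 < c := by positivity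
    have hcp : c ^ p = I⁻¹ := by
      rw [hc, ← Real.rpow_mul (by positivity), one_div_mul_cancel hp0.ne', Real.rpow_one]
    have h1 := h _ (test_smul c hu) (fun x => mul_nonneg hc0.le (hu0 x)) ?_
    · rw [Qp_smul hp0 hc0.le hu, Qp_smul hp0 hc0.le hu, hcp, ← mul_add, le_inv_mul_iff₀ h0] at h1
      linarith
    · have : ∀ x, |c * u x| ^ p = I⁻¹ * |u x| ^ p := fun x => by
        rw [abs_mul, abs_of_pos hc0, Real.mul_rpow hc0.le (abs_nonneg _), hcp]
      simp only [this]
      rw [integral_const_mul, ← hI, inv_mul_cancel₀ h0.ne']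

lemma lin (hp : 0 < p) {V₀ V₁ : Ed d → ℝ} (hV₀ : LocBddOn Ω V₀) (hV₁ : LocBddOn Ω V₁)
    (hu : IsTestOn Ω u) (s : ℝ) :
    Qp p Ω (fun x => s * V₁ x + (1 - s) * V₀ x) u = s * Qp p Ω V₁ u + (1 - s) * Qp p Ω V₀ u := by
  rw [Qp_eq hp hu, Qp_eq hp hu, Qp_eq hp hu, ← integral_const_mul, ← integral_const_mul,
    ← integral_add ((int_dens hp hV₁ hu).const_mul _) ((int_dens hp hV₀ hu).const_mul _)]
  congr 1
  ext x
  ring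

lemma lin_loc {V₀ V₁ : Ed d → ℝ} (hV₀ : LocBddOn Ω V₀) (hV₁ : LocBddOn Ω V₁) (s : ℝ) :
    LocBddOn Ω (fun x => s * V₁ x + (1 - s) * V₀ x) := by
  refine ⟨(hV₁.1.const_mul s).add (hV₀.1.const_mul (1 - s)), fun K hK hKΩ => ?_⟩
  obtain ⟨M0, h0⟩ := hV₀.2 K hK hKΩ
  obtain ⟨M1, h1⟩ := hV₁.2 K hK hKΩ
  refine ⟨|s| * M1 + |1 - s| * M0, ?_⟩
  filter_upwards [h0, h1] with x a b hx
  refine (abs_add_le _ _).trans ?_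
  rw [abs_mul, abs_mul]
  have := a hx
  have := b hx
  gcongr

lemma final (hp : 1 < p) (hopen : IsOpen Ω) (hconn : IsConnected Ω)
    (V₀ V₁ : Ed d → ℝ) (hV₀ : LocBddOn Ω V₀) (hV₁ : LocBddOn Ω V₁)
    (hnn₀ : NonnegOn p Ω V₀) (hnn₁ : NonnegOn p Ω V₁) :
    (∀ s ∈ Set.Icc (0:ℝ) 1, NonnegOn p Ω (fun x => s * V₁ x + (1 - s) * V₀ x)) ∧
    (0 < volume {x ∈ Ω | V₀ x ≠ V₁ x} →
      ∀ s ∈ Set.Ioo (0:ℝ) 1, SubcriticalOn p Ω (fun x => s * V₁ x + (1 - s) * V₀ x)) := by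
  have hp0 : 0 < p := by linarith
  have hfirst : ∀ s ∈ Set.Icc (0:ℝ) 1, NonnegOn p Ω (fun x => s * V₁ x + (1 - s) * V₀ x) := by
    intro s hs u hu
    rw [lin hp0 hV₀ hV₁ hu]
    exact add_nonneg (mul_nonneg hs.1 (hnn₁ u hu)) (mul_nonneg (sub_nonneg.2 hs.2) (hnn₀ u hu))
  refine ⟨hfirst, fun hE s hs => ?_⟩
  have hQs := hfirst s ⟨hs.1.le, hs.2.le⟩
  have hVs := lin_loc hV₀ hV₁ s
  obtain ⟨x1, hx1, ρ0, hρ0, η, hη, hcl⟩ := claimC hp hV₀ hV₁ hnn₀ hnn₁ hopen hE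
  set m := min s (1 - s) with hm
  have hm0 : 0 < m := lt_min hs.1 (sub_pos.2 hs.2)
  have hA := lemmaA hp hVs hQs hopen hconn.isPreconnected hx1 hρ0
  refine build_W hp hconn.nonempty hQs fun x hx => ?_
  obtain ⟨ρ, hρ, C, hC, h⟩ := hA x hx
  refine ⟨ρ, hρ, 1 / (C * (1 + 1 / (m * η))), by positivity, fun u hu => signed hp hVs ?_ hu⟩
  intro u hu hu0
  have h1 := h u hu hu0
  have h2 := hcl u hu hu0
  have h3 : m * (Qp p Ω V₀ u + Qp p Ω V₁ u) ≤ Qp p Ω (fun x => s * V₁ x + (1 - s) * V₀ x) u := by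
    rw [lin hp0 hV₀ hV₁ hu]
    have a := mul_le_mul_of_nonneg_right (min_le_left s (1 - s)) (hnn₁ u hu)
    have b := mul_le_mul_of_nonneg_right (min_le_right s (1 - s)) (hnn₀ u hu)
    rw [← hm] at a b
    linarith
  set Q := Qp p Ω (fun x => s * V₁ x + (1 - s) * V₀ x) u
  set I := ∫ y in Metric.closedBall x1 ρ0, |u y| ^ p
  have h4 : m * η * I ≤ Q := by
    have := mul_le_mul_of_nonneg_left h2 hm0.le
    linarith
  have h5 : I ≤ 1 / (m * η) * Q := by
    rw [one_div, le_inv_mul_iff₀ (by positivity)]; exact h4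
  rw [one_div, inv_mul_le_iff₀ (by positivity)]
  refine h1.trans ?_
  rw [mul_assoc]
  gcongr
  linarith

end S17

/-- Proposition 13.10 (convexity): if `Q_{V₀}` and `Q_{V₁}` are nonnegative in Ω
then `Q_s = Q_{sV₁+(1-s)V₀}` is nonnegative for `s ∈ [0,1]`; if moreover `V₀ ≠ V₁`
on a set of positive measure, then `Q_s` is subcritical for `s ∈ (0,1)`. -/
theorem stmt17 (d : ℕ) (p : ℝ) (hp : 1 < p) (Ω : Set (Ed d))
    (hopen : IsOpen Ω) (hconn : IsConnected Ω)
    (V₀ V₁ : Ed d → ℝ) (hV₀ : LocBddOn Ω V₀) (hV₁ : LocBddOn Ω V₁)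
    (hnn₀ : NonnegOn p Ω V₀) (hnn₁ : NonnegOn p Ω V₁) :
    (∀ s ∈ Set.Icc (0 : ℝ) 1,
      NonnegOn p Ω (fun x => s * V₁ x + (1 - s) * V₀ x)) ∧
    (0 < volume {x ∈ Ω | V₀ x ≠ V₁ x} →
      ∀ s ∈ Set.Ioo (0 : ℝ) 1,
        SubcriticalOn p Ω (fun x => s * V₁ x + (1 - s) * V₀ x)) := by
  exact S17.final hp hopen hconn V₀ V₁ hV₀ hV₁ hnn₀ hnn₁
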